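/- arXiv:1611.01424 — 3 statements merged into one kernel-verified Lean document; each statement's English description precedes it below -/
import Mathlib

section
/- For every n ≥ 2 there exists an element w ∈ F_n with the following property: whenever φ and Ψ are endomorphisms of F_n such that the image Ψ(F_n) is non-cyclic and φ(w) = Ψ(w), there exists S ∈ F_n with φ(g) = S Ψ(g) S⁻¹ for all g ∈ F_n and such that the subgroup ⟨S, Ψ(w)⟩ of F_n is infinite cyclic; moreover, if n = 2 then S can be chosen in ⟨Ψ(w)⟩, i.e., S = Ψ(w)^k for some k ∈ ℤ. -/
namespace FreeGroup

variable {α : Type*} [DecidableEq α]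

/-- The word metric of a free group with respect to its free generators. -/
def wdist (x y : FreeGroup α) : ℤ := (x⁻¹ * y).norm

theorem wdist_nonneg (x y : FreeGroup α) : 0 ≤ wdist x y := by
  unfold wdist; positivity

@[simp] theorem wdist_self (x : FreeGroup α) : wdist x x = 0 := by simp [wdist]

theorem wdist_comm (x y : FreeGroup α) : wdist x y = wdist y x := by
  rw [wdist, wdist, ← norm_inv_eq]; simp

theorem eq_of_wdist_eq_zero {x y : FreeGroup α} (h : wdist x y = 0) : x = y := by
  simpa [wdist, inv_mul_eq_one] using h

theorem wdist_pos {x y : FreeGroup α} (h : x ≠ y) : 0 < wdist x y :=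
  lt_of_le_of_ne (wdist_nonneg x y) fun h0 => h (eq_of_wdist_eq_zero h0.symm)

@[simp] theorem wdist_mul_left (g x y : FreeGroup α) : wdist (g * x) (g * y) = wdist x y := by
  simp [wdist, mul_assoc]

theorem wdist_triangle (x y z : FreeGroup α) : wdist x z ≤ wdist x y + wdist y z := by
  unfold wdist
  have := norm_mul_le (x⁻¹ * y) (y⁻¹ * z)
  rw [show x⁻¹ * y * (y⁻¹ * z) = x⁻¹ * z by group] at this
  exact_mod_cast this

theorem exists_append_append_head_ne {β : Type*} [DecidableEq β] (u v : List β) :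
    ∃ A B C, u = A ++ B ∧ v = A ++ C ∧ ∀ b ∈ B.head?, ∀ c ∈ C.head?, b ≠ c := by
  induction u generalizing v with
  | nil => exact ⟨[], [], v, by simp, by simp, by simp⟩
  | cons a u ih =>
    cases v with
    | nil => exact ⟨[], a :: u, [], by simp, by simp, by simp⟩
    | cons b v =>
      by_cases hab : a = b
      · obtain ⟨A, B, C, h1, h2, h3⟩ := ih v
        exact ⟨a :: A, B, C, by simp [h1], by simp [h2, hab], h3⟩
      · exact ⟨[], a :: u, b :: v, by simp, by simp, by simpa using hab⟩

theorem isReduced_invRev_append {B C : List (α × Bool)} (hB : IsReduced B) (hC : IsReduced C)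
    (h : ∀ b ∈ B.head?, ∀ c ∈ C.head?, b ≠ c) : IsReduced (invRev B ++ C) := by
  have hB' : IsReduced (invRev B) := by
    have := isReduced_toWord (x := (mk B)⁻¹)
    rwa [inv_mk, toWord_mk, reduce_invRev, isReduced_iff_reduce_eq.1 hB] at this
  rw [IsReduced, List.isChain_append]
  refine ⟨hB', hC, ?_⟩
  intro x hx y hy hxy
  cases B with
  | nil => simp [invRev] at hx
  | cons b B =>
    simp [invRev] at hx
    have := h b (by simp) y hy
    subst hx
    rcases b with ⟨b1, b2⟩
    rcases y with ⟨y1, y2⟩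
    simp only at hxy ⊢
    subst hxy
    have h2 : b2 ≠ y2 := fun e => this (by rw [e])
    revert h2
    cases b2 <;> cases y2 <;> simp

theorem exists_common_prefix_length (g h : FreeGroup α) :
    ∃ k : ℕ, g.toWord.take k = h.toWord.take k ∧ k ≤ g.norm ∧ k ≤ h.norm ∧
      wdist g h = g.norm + h.norm - 2 * k ∧
      ∀ j : ℕ, j ≤ g.norm → j ≤ h.norm → g.toWord.take j = h.toWord.take j → j ≤ k := by
  obtain ⟨A, B, C, h1, h2, h3⟩ := exists_append_append_head_ne g.toWord h.toWord
  have hB : IsReduced B := (List.isChain_append.1 (h1 ▸ isReduced_toWord (x := g))).2.1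
  have hC : IsReduced C := (List.isChain_append.1 (h2 ▸ isReduced_toWord (x := h))).2.1
  have hr := isReduced_invRev_append hB hC h3
  have hg : g = mk A * mk B := by rw [mul_mk, ← h1, mk_toWord]
  have hh : h = mk A * mk C := by rw [mul_mk, ← h2, mk_toWord]
  have hgh : g⁻¹ * h = mk (invRev B ++ C) := by
    rw [← mul_mk, ← inv_mk, hg, hh]; group
  have hn : (g⁻¹ * h).norm = B.length + C.length := by
    rw [hgh, norm, toWord_mk, isReduced_iff_reduce_eq.1 hr]; simp
  have hng : g.norm = A.length + B.length := by rw [norm, h1]; simp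
  have hnh : h.norm = A.length + C.length := by rw [norm, h2]; simp
  refine ⟨A.length, by simp [h1, h2], by omega, by omega, ?_, ?_⟩
  · rw [wdist, hn, hng, hnh]; push_cast; ring
  · intro j hjg hjh hj
    by_contra hlt
    push Not at hlt
    obtain ⟨i, rfl⟩ := Nat.exists_eq_add_of_lt hlt
    rw [h1, h2, List.take_append, List.take_append] at hj
    cases B with
    | nil => simp at hng; omega
    | cons b B =>
      cases C with
      | nil => simp at hnh; omega
      | cons c C =>
        apply h3 b (by simp) c (by simp)
        have : A.length + i + 1 - A.length = i + 1 := by omega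
        rw [this] at hj
        simp only [List.take_succ_cons, List.append_cancel_left_eq] at hj
        exact (List.cons.inj hj).1

theorem wdist_four_point (x y z t : FreeGroup α) :
    wdist x y + wdist z t ≤ wdist x z + wdist y t ∨
      wdist x y + wdist z t ≤ wdist x t + wdist y z := by
  have key : ∀ x y z : FreeGroup α, wdist x y + z.norm ≤ wdist x z + y.norm ∨
      wdist x y + z.norm ≤ x.norm + wdist y z := by
    intro x y z
    obtain ⟨k1, e1, a1, b1, d1, m1⟩ := exists_common_prefix_length x y
    obtain ⟨k2, e2, a2, b2, d2, m2⟩ := exists_common_prefix_length x z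
    obtain ⟨k3, e3, a3, b3, d3, m3⟩ := exists_common_prefix_length y z
    have := m1 (min k2 k3) (by omega) (by omega) (by
      have h2 := congrArg (List.take (min k2 k3)) e2
      have h3 := congrArg (List.take (min k2 k3)) e3
      simp only [List.take_take] at h2 h3
      rw [show min (min k2 k3) k2 = min k2 k3 by omega] at h2
      rw [show min (min k2 k3) k3 = min k2 k3 by omega] at h3
      rw [h2, h3])
    rw [d1, d2, d3]; omega
  have := key (t⁻¹ * x) (t⁻¹ * y) (t⁻¹ * z)
  rw [wdist_mul_left, wdist_mul_left, wdist_mul_left] at this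
  rw [wdist_comm z t, wdist_comm y t, wdist_comm x t]
  exact this

theorem wdist_parity (x y z : FreeGroup α) : 2 ∣ wdist x y + wdist y z + wdist x z := by
  obtain ⟨k, -, -, -, d, -⟩ := exists_common_prefix_length (y⁻¹ * x) (y⁻¹ * z)
  rw [wdist_mul_left] at d
  have h1 : wdist y x = (y⁻¹ * x).norm := rfl
  have h2 : wdist y z = (y⁻¹ * z).norm := rfl
  rw [d, wdist_comm x y, h1, h2]
  exact ⟨(y⁻¹ * x).norm + (y⁻¹ * z).norm - k, by ring⟩

theorem exists_between (x y : FreeGroup α) {k : ℤ} (h0 : 0 ≤ k) (h1 : k ≤ wdist x y) :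
    ∃ m, wdist x m = k ∧ wdist m y = wdist x y - k := by
  obtain ⟨k, rfl⟩ := Int.eq_ofNat_of_zero_le h0
  set w := (x⁻¹ * y).toWord with hw
  have hl : wdist x y = w.length := rfl
  have hk : k ≤ w.length := by omega
  have hr : IsReduced w := isReduced_toWord
  have hA : IsReduced (w.take k) := List.IsChain.take hr k
  have hB : IsReduced (w.drop k) := List.IsChain.drop hr k
  refine ⟨x * mk (w.take k), ?_, ?_⟩
  · rw [wdist, inv_mul_cancel_left, norm, toWord_mk, isReduced_iff_reduce_eq.1 hA]
    simp [hk]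
  · have : y = x * (mk (w.take k) * mk (w.drop k)) := by
      rw [mul_mk, List.take_append_drop, hw, mk_toWord]; group
    have h2 : (x * mk (w.take k))⁻¹ * y = mk (w.drop k) := by
      conv_lhs => rw [this]
      group
    rw [wdist, h2, norm, toWord_mk, isReduced_iff_reduce_eq.1 hB, hl]
    simp; omega

/-- Two geodesics glue to a geodesic when they overlap in a non-degenerate segment. -/
theorem wdist_add_of_overlap {x y z w : FreeGroup α} (h1 : wdist x z = wdist x y + wdist y z)
    (h2 : wdist y w = wdist y z + wdist z w) (h : y ≠ z) :
    wdist x w = wdist x y + wdist y z + wdist z w := by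
  have a := wdist_four_point x z y w
  have b := wdist_triangle x z w
  have c := wdist_pos h
  have := wdist_comm y z
  omega

theorem wdist_chain (y : ℕ → FreeGroup α) (h0 : ∀ i, 0 < wdist (y i) (y (i + 1)))
    (h : ∀ i, wdist (y i) (y (i + 2)) = wdist (y i) (y (i + 1)) + wdist (y (i + 1)) (y (i + 2)))
    {i j k : ℕ} (hij : i ≤ j) (hjk : j ≤ k) :
    wdist (y i) (y k) = wdist (y i) (y j) + wdist (y j) (y k) := by
  have step : ∀ i d, wdist (y i) (y (i + d + 2)) =
      wdist (y i) (y (i + d + 1)) + wdist (y (i + d + 1)) (y (i + d + 2)) := by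
    intro i d
    induction d with
    | zero => exact h i
    | succ d ih =>
      have := wdist_add_of_overlap ih (h (i + d + 1)) (by
        intro e; have := h0 (i + d + 1); rw [e] at this; simp at this)
      simp only [show i + (d + 1) + 2 = i + d + 1 + 2 by ring,
        show i + (d + 1) + 1 = i + d + 1 + 1 by ring] at *
      rw [this, ih]
  have step' : ∀ i j, i ≤ j →
      wdist (y i) (y (j + 1)) = wdist (y i) (y j) + wdist (y j) (y (j + 1)) := by
    intro i j hij
    obtain ⟨d, rfl⟩ := Nat.exists_eq_add_of_le hij
    cases d with
    | zero => simp
    | succ d => exact step i d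
  induction k, hjk using Nat.le_induction with
  | base => simp
  | succ k hk ih => rw [step' i k (hij.trans hk), step' j k hk, ih]; ring

theorem wdist_chain_sum (y : ℕ → FreeGroup α) (h0 : ∀ i, 0 < wdist (y i) (y (i + 1)))
    (h : ∀ i, wdist (y i) (y (i + 2)) = wdist (y i) (y (i + 1)) + wdist (y (i + 1)) (y (i + 2)))
    (j : ℕ) : wdist (y 0) (y j) = ∑ i ∈ Finset.range j, wdist (y i) (y (i + 1)) := by
  induction j with
  | zero => simp
  | succ j ih =>
    rw [Finset.sum_range_succ, ← ih]
    exact wdist_chain y h0 h (Nat.zero_le _) (Nat.le_succ _)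

/-- A bi-infinite geodesic. -/
def IsLine (l : ℤ → FreeGroup α) : Prop := ∀ s t, wdist (l s) (l t) = (s - t).natAbs

theorem exists_geodesic (x y : FreeGroup α) : ∃ m : ℤ → FreeGroup α, m 0 = x ∧
    m (wdist x y) = y ∧ ∀ s t, 0 ≤ s → s ≤ t → t ≤ wdist x y → wdist (m s) (m t) = t - s := by
  have : ∀ k : ℤ, ∃ m, 0 ≤ k → k ≤ wdist x y → wdist x m = k ∧ wdist m y = wdist x y - k := by
    intro k
    by_cases h : 0 ≤ k ∧ k ≤ wdist x y
    · obtain ⟨m, hm⟩ := exists_between x y h.1 h.2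
      exact ⟨m, fun _ _ => hm⟩
    · exact ⟨1, fun a b => absurd ⟨a, b⟩ h⟩
  choose m hm using this
  refine ⟨m, ?_, ?_, ?_⟩
  · exact (eq_of_wdist_eq_zero (hm 0 le_rfl (wdist_nonneg _ _)).1).symm
  · refine eq_of_wdist_eq_zero ?_
    rw [(hm _ (wdist_nonneg _ _) le_rfl).2, sub_self]
  · intro s t h0 hst h1
    have a := hm s h0 (by omega)
    have b := hm t (by omega) h1
    have c := wdist_four_point (m s) (m t) x y
    have d := wdist_triangle x (m s) (m t)
    rw [wdist_comm (m s) x, wdist_comm (m t) x] at c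
    omega

theorem IsLine.exists_proj {l : ℤ → FreeGroup α} (hl : IsLine l) (x : FreeGroup α) :
    ∃ s, ∀ t, wdist x (l t) = wdist x (l s) + (t - s).natAbs := by
  obtain ⟨s, -, hs⟩ := WellFounded.has_min (InvImage.wf (fun t => (wdist x (l t)).toNat)
    Nat.lt_wfRel.wf) Set.univ ⟨0, trivial⟩
  have hs' : ∀ t, wdist x (l s) ≤ wdist x (l t) := by
    intro t
    have := hs t trivial
    have h1 := wdist_nonneg x (l t)
    have h2 := wdist_nonneg x (l s)
    simp only [InvImage] at this
    change ¬ ((wdist x (l t)).toNat < (wdist x (l s)).toNat) at this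
    omega
  have step : ∀ t, (t - s).natAbs = 1 → wdist x (l t) = wdist x (l s) + 1 := by
    intro t ht
    have h1 := wdist_parity x (l s) (l t)
    have h2 := hl s t
    have h3 := wdist_triangle x (l s) (l t)
    have h4 := hs' t
    omega
  refine ⟨s, fun t => ?_⟩
  have main : ∀ t', (t' - s).natAbs = 1 → (t - s).natAbs = 1 + (t - t').natAbs →
      wdist x (l t) = wdist x (l s) + (t - s).natAbs := by
    intro t' h1 h2
    have a := step t' h1
    have b := hl s t'
    have c := hl s t
    have d := hl t' t
    have := wdist_add_of_overlap (x := x) (y := l s) (z := l t') (w := l t) (by omega) (by omega)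
      (by rintro e; rw [e, wdist_self] at b; omega)
    omega
  rcases lt_trichotomy s t with h | h | h
  · exact main (s + 1) (by omega) (by omega)
  · simp [h]
  · exact main (s - 1) (by omega) (by omega)

theorem IsLine.eq_of_between {l : ℤ → FreeGroup α} (hl : IsLine l) {x : FreeGroup α} {s t : ℤ}
    (h : wdist (l s) x + wdist x (l t) = t - s) : x = l (s + wdist (l s) x) := by
  obtain ⟨p, hp⟩ := hl.exists_proj x
  have h1 := hp s
  have h2 := hp t
  have h3 := wdist_nonneg x (l p)
  rw [wdist_comm (l s) x] at *
  have : x = l p := eq_of_wdist_eq_zero (by omega)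
  have h4 : s + wdist x (l s) = p := by omega
  rw [h4]; exact this

theorem IsLine.inj {l : ℤ → FreeGroup α} (hl : IsLine l) {s t : ℤ} (h : l s = l t) : s = t := by
  have := hl s t
  rw [h, wdist_self] at this; omega

/-- The line `l` is translated by `u` with positive translation length `L`. -/
structure IsAxis (u : FreeGroup α) (L : ℤ) (l : ℤ → FreeGroup α) : Prop where
  pos : 0 < L
  line : IsLine l
  map : ∀ t, u * l t = l (t + L)

namespace IsAxis

variable {u v g h : FreeGroup α} {L L' : ℤ} {l l' : ℤ → FreeGroup α}

theorem conj (a : IsAxis u L l) (h : FreeGroup α) :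
    IsAxis (h * u * h⁻¹) L (fun t => h * l t) where
  pos := a.pos
  line s t := by rw [wdist_mul_left, a.line]
  map t := by rw [← a.map]; group

theorem shift (a : IsAxis u L l) (c : ℤ) : IsAxis u L (fun t => l (t + c)) where
  pos := a.pos
  line s t := by rw [a.line]; congr 2; ring
  map t := by rw [a.map]; congr 1; ring

theorem inv_mul (a : IsAxis u L l) (t : ℤ) : u⁻¹ * l t = l (t - L) := by
  rw [inv_mul_eq_iff_eq_mul, a.map]; simp

theorem rev (a : IsAxis u L l) : IsAxis u⁻¹ L (fun t => l (-t)) where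
  pos := a.pos
  line s t := by rw [a.line]; congr 1; omega
  map t := by rw [a.inv_mul]; congr 1; ring

theorem zpow_mul (a : IsAxis u L l) (k t : ℤ) : u ^ k * l t = l (t + k * L) := by
  induction k using Int.induction_on generalizing t with
  | zero => simp
  | succ k ih => rw [zpow_add_one, mul_assoc, a.map, ih]; congr 1; ring
  | pred k ih => rw [zpow_sub_one, mul_assoc, a.inv_mul, ih]; congr 1; ring

theorem pow_mul (a : IsAxis u L l) (k : ℕ) (t : ℤ) : u ^ k * l t = l (t + k * L) := by
  simpa using a.zpow_mul k t

theorem pow (a : IsAxis u L l) {k : ℕ} (hk : 0 < k) : IsAxis (u ^ k) (k * L) l where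
  pos := by have := a.pos; positivity
  line := a.line
  map t := a.pow_mul k t

theorem ne_one (a : IsAxis u L l) : u ≠ 1 := by
  rintro rfl
  have h1 := a.line.inj ((one_mul _).symm.trans (a.map 0))
  have := a.pos
  omega

theorem wdist_mul (a : IsAxis u L l) {x : FreeGroup α} {s : ℤ}
    (hs : ∀ t, wdist x (l t) = wdist x (l s) + (t - s).natAbs) :
    wdist x (u * x) = 2 * wdist x (l s) + L := by
  have h1 := hs (s + L)
  have h2 : wdist (l s) (u * x) = wdist x (l s) + L := by
    have := hs (s - L)
    rw [← wdist_mul_left u, a.map, wdist_comm] at this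
    simp only [sub_add_cancel] at this
    rw [this]; have := a.pos; omega
  have h3 : wdist (l (s + L)) (u * x) = wdist x (l s) := by
    rw [← a.map, wdist_mul_left, wdist_comm]
  have h4 := a.line s (s + L)
  have h5 := a.pos
  rw [wdist_add_of_overlap (y := l s) (z := l (s + L)) (by omega) (by omega)]
  · omega
  · intro e; have := a.line.inj e; omega

theorem le_wdist (a : IsAxis u L l) (x : FreeGroup α) : L ≤ wdist x (u * x) := by
  obtain ⟨s, hs⟩ := a.line.exists_proj x
  rw [a.wdist_mul hs]
  have := wdist_nonneg x (l s)
  omega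

theorem exists_eq_of_wdist_sq (a : IsAxis u L l) {x : FreeGroup α}
    (h : wdist x (u * (u * x)) = 2 * wdist x (u * x)) : ∃ s, x = l s := by
  obtain ⟨s, hs⟩ := a.line.exists_proj x
  have h1 := a.wdist_mul hs
  have h2 := (a.pow (k := 2) (by norm_num)).wdist_mul hs
  rw [pow_two, mul_assoc] at h2
  push_cast at h2
  refine ⟨s, eq_of_wdist_eq_zero ?_⟩
  have := wdist_nonneg x (l s)
  omega

theorem unique (a : IsAxis u L l) (a' : IsAxis u L' l') :
    L' = L ∧ ∃ c, ∀ t, l' t = l (t + c) := by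
  have hmem : ∀ t, ∃ s, l' t = l s := by
    intro t
    apply a.exists_eq_of_wdist_sq
    rw [a'.map, a'.map, a'.line, a'.line]
    omega
  choose f hf using hmem
  have hL : L' = L := by
    have h1 := a'.line 0 (0 + L')
    rw [← a'.map, hf 0, a.map, a.line] at h1
    have := a.pos; have := a'.pos; omega
  subst hL
  have hadd : ∀ (n : ℕ) t, f (t + n * L') = f t + n * L' := by
    intro n t
    apply a.line.inj
    rw [← hf, ← a'.pow_mul, ← a.pow_mul, hf]
  refine ⟨rfl, f 0, fun t => ?_⟩
  rw [hf]
  congr 1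
  obtain ⟨n, hn⟩ : ∃ n : ℕ, n = t.natAbs + (f t - f 0).natAbs := ⟨_, rfl⟩
  have e1 := a'.line (t + n * L') 0
  rw [hf, hf, a.line, hadd] at e1
  have h2 : (n : ℤ) ≤ n * L' := by nlinarith [a.pos]
  generalize (n : ℤ) * L' = N at *
  omega

theorem exists_translation (a : IsAxis u L l) {x : FreeGroup α} (h : Commute x u) :
    ∃ c, ∀ t, x * l t = l (t + c) := by
  have := a.conj x
  rw [h.eq, mul_inv_cancel_right] at this
  exact (a.unique this).2

end IsAxis

/-- The translation length of `g`. -/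
noncomputable def tlen (g : FreeGroup α) : ℤ := ((⨅ o : FreeGroup α, (o⁻¹ * (g * o)).norm : ℕ) : ℤ)

theorem tlen_le (g o : FreeGroup α) : tlen g ≤ wdist o (g * o) := by
  unfold tlen wdist
  exact_mod_cast ciInf_le (OrderBot.bddBelow _) o

theorem exists_tlen (g : FreeGroup α) : ∃ o, wdist o (g * o) = tlen g := by
  obtain ⟨o, ho⟩ := Nat.sInf_mem (Set.range_nonempty fun o : FreeGroup α => (o⁻¹ * (g * o)).norm)
  exact ⟨o, by unfold tlen wdist; exact_mod_cast ho⟩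

theorem tlen_nonneg (g : FreeGroup α) : 0 ≤ tlen g := by
  unfold tlen; positivity

@[simp] theorem tlen_one : tlen (1 : FreeGroup α) = 0 :=
  le_antisymm (by simpa using tlen_le (1 : FreeGroup α) 1) (tlen_nonneg _)

theorem IsAxis.tlen_eq {u : FreeGroup α} {L : ℤ} {l : ℤ → FreeGroup α} (a : IsAxis u L l) :
    tlen u = L := by
  refine le_antisymm ?_ ?_
  · have := tlen_le u (l 0)
    rw [a.map, a.line] at this
    have := a.pos; omega
  · obtain ⟨o, ho⟩ := exists_tlen u
    rw [← ho]; exact a.le_wdist o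

theorem wdist_sq_of_wdist_eq_tlen {u x : FreeGroup α} (hu : u ≠ 1) (hx : wdist x (u * x) = tlen u) :
    wdist x (u * (u * x)) = 2 * tlen u := by
  have hpos : 0 < wdist x (u * x) := wdist_pos (by simpa using hu)
  obtain ⟨p, hp1, hp2⟩ := exists_between x (u * x) (k := 1) (by omega) (by omega)
  obtain ⟨q, hq1, hq2⟩ := exists_between x (u * x) (k := tlen u - 1) (by omega) (by omega)
  by_contra hne
  have tri := wdist_triangle x (u * x) (u * (u * x))
  have par := wdist_parity x (u * x) (u * (u * x))
  have e0 : wdist (u * x) (u * (u * x)) = tlen u := by rw [wdist_mul_left, hx]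
  have e1 : wdist (u * x) (u * p) = 1 := by rw [wdist_mul_left, hp1]
  have e2 : wdist (u * p) (u * (u * x)) = tlen u - 1 := by rw [wdist_mul_left]; omega
  -- the first step after `u * x` backtracks
  have hqp : wdist q (u * p) = 0 := by
    have f1 := wdist_four_point x (u * p) (u * x) (u * (u * x))
    have f2 : wdist x (u * p) ≤ tlen u - 1 := by
      have := wdist_parity x (u * x) (u * p)
      rw [wdist_comm (u * p) (u * x)] at f1
      omega
    have f3 := wdist_four_point q (u * p) x (u * x)
    have f4 := wdist_comm q x
    have f5 := wdist_nonneg q (u * p)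
    have f6 := wdist_comm (u * p) (u * x)
    have f7 := wdist_comm (u * p) x
    omega
  have hqp := eq_of_wdist_eq_zero hqp
  have hp := tlen_le u p
  rw [← hqp] at hp
  have f1 := wdist_four_point p q x (u * x)
  have f2 := wdist_comm p x
  have f3 := wdist_comm q x
  have hL : tlen u = 1 := by omega
  have hqx : q = x := (eq_of_wdist_eq_zero (by omega)).symm
  have hpx : p = u * x := eq_of_wdist_eq_zero (by omega)
  have : u * u = 1 := by
    rw [hqx, hpx, ← mul_assoc] at hqp
    exact (right_eq_mul.1 hqp)
  rw [← pow_two] at this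
  exact hu (by simpa using this)

theorem exists_isAxis {u : FreeGroup α} (hu : u ≠ 1) : ∃ l, IsAxis u (tlen u) l := by
  obtain ⟨x, hx⟩ := exists_tlen u
  have hsq := wdist_sq_of_wdist_eq_tlen hu hx
  have hpos : 0 < tlen u := hx ▸ wdist_pos (by simpa using hu)
  have hnat : ∀ n : ℕ, wdist x (u ^ n * x) = n * tlen u := by
    intro n
    have := wdist_chain_sum (fun i => u ^ i * x)
      (fun i => by rw [pow_succ, mul_assoc, wdist_mul_left, hx]; exact hpos)
      (fun i => by
        have : u ^ (i + 2) * x = u ^ i * (u * (u * x)) := by rw [pow_add, pow_two]; group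
        rw [this, pow_succ, mul_assoc, wdist_mul_left, wdist_mul_left, wdist_mul_left, hsq,
          wdist_mul_left, hx]
        ring) n
    simp only [pow_zero, one_mul] at this
    rw [this, Finset.sum_congr rfl (g := fun _ => tlen u)
      (fun i _ => by rw [pow_succ, mul_assoc, wdist_mul_left, hx])]
    simp
  have hz : ∀ i j : ℤ, i ≤ j → wdist (u ^ i * x) (u ^ j * x) = (j - i) * tlen u := by
    intro i j hij
    obtain ⟨n, rfl⟩ := Int.le.dest hij
    rw [zpow_add, mul_assoc, wdist_mul_left, zpow_natCast, hnat]; ring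
  obtain ⟨m, m0, m1, hm⟩ := exists_geodesic x (u * x)
  rw [hx] at m1 hm
  refine ⟨fun t => u ^ (t / tlen u) * m (t % tlen u), hpos, ?_, ?_⟩
  · have key : ∀ s t, s ≤ t → wdist (u ^ (s / tlen u) * m (s % tlen u))
        (u ^ (t / tlen u) * m (t % tlen u)) = t - s := by
      intro s t hst
      have a1 := Int.emod_add_mul_ediv s (tlen u)
      have a2 := Int.emod_add_mul_ediv t (tlen u)
      have b1 := Int.emod_nonneg s hpos.ne'
      have b2 := Int.emod_nonneg t hpos.ne'
      have c1 := Int.emod_lt_of_pos s hpos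
      have c2 := Int.emod_lt_of_pos t hpos
      have hq := Int.ediv_le_ediv hpos hst
      set i := s / tlen u
      set j := t / tlen u
      set s' := s % tlen u
      set t' := t % tlen u
      have x1 : wdist (u ^ i * x) (u ^ i * m s') = s' := by
        rw [wdist_mul_left, ← m0, hm _ _ le_rfl b1 c1.le]; ring
      have x2 : wdist (u ^ i * m s') (u ^ (i + 1) * x) = tlen u - s' := by
        rw [zpow_add_one, mul_assoc, wdist_mul_left, ← m1, hm _ _ b1 c1.le le_rfl]
      have y1 : wdist (u ^ j * x) (u ^ j * m t') = t' := by
        rw [wdist_mul_left, ← m0, hm _ _ le_rfl b2 c2.le]; ring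
      have y2 : wdist (u ^ j * m t') (u ^ (j + 1) * x) = tlen u - t' := by
        rw [zpow_add_one, mul_assoc, wdist_mul_left, ← m1, hm _ _ b2 c2.le le_rfl]
      have z1 := hz i (j + 1) (by omega)
      rcases hq.eq_or_lt with e | e
      · rw [← e] at a2 ⊢
        rw [wdist_mul_left, hm _ _ b1 (by omega) c2.le]; omega
      · have z2 := hz (i + 1) j e
        have t1 := wdist_triangle (u ^ i * m s') (u ^ (i + 1) * x) (u ^ j * x)
        have t2 := wdist_triangle (u ^ i * m s') (u ^ j * x) (u ^ j * m t')
        have t3 := wdist_triangle (u ^ i * x) (u ^ i * m s') (u ^ (j + 1) * x)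
        have t4 := wdist_triangle (u ^ i * m s') (u ^ j * m t') (u ^ (j + 1) * x)
        have : (j - (i + 1)) * tlen u = tlen u * j - tlen u * i - tlen u := by ring
        have : (j + 1 - i) * tlen u = tlen u * j - tlen u * i + tlen u := by ring
        omega
    intro s t
    rcases le_total s t with h | h
    · rw [key s t h]; omega
    · rw [wdist_comm, key t s h]; omega
  · intro t
    simp only [Int.add_ediv_of_dvd_right (dvd_refl _), Int.ediv_self hpos.ne', Int.add_emod_right]
    rw [← mul_assoc]; congr 1; rw [add_comm, zpow_add, zpow_one]

theorem tlen_conj (h g : FreeGroup α) : tlen (h * g * h⁻¹) = tlen g := by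
  by_cases hg : g = 1
  · simp [hg]
  · obtain ⟨l, a⟩ := exists_isAxis hg
    exact (a.conj h).tlen_eq

omit [DecidableEq α] in
theorem commute_of_translations {x z : FreeGroup α} {l : ℤ → FreeGroup α} {t c d : ℤ}
    (h1 : x * l t = l (t + c)) (h2 : z * l t = l (t + d)) (h3 : x * l (t + d) = l (t + d + c))
    (h4 : z * l (t + c) = l (t + c + d)) : Commute x z := by
  refine mul_right_cancel (b := l t) ?_
  rw [mul_assoc, mul_assoc, h1, h2, h3, h4]; congr 1; ring

theorem commute_trans {x y z : FreeGroup α} (hy : y ≠ 1) (h1 : Commute x y) (h2 : Commute y z) :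
    Commute x z := by
  obtain ⟨l, a⟩ := exists_isAxis hy
  obtain ⟨c, hc⟩ := a.exists_translation h1
  obtain ⟨d, hd⟩ := a.exists_translation h2.symm
  exact commute_of_translations (hc 0) (hd 0) (hc _) (hd _)

theorem commute_of_commute_conj {x z : FreeGroup α} (hx : x ≠ 1) (h : Commute x (z * x * z⁻¹)) :
    Commute z x := by
  obtain ⟨l, a⟩ := exists_isAxis hx
  obtain ⟨c, hc⟩ := a.exists_translation h.symm
  have b := a.conj z
  rcases lt_trichotomy c 0 with h0 | h0 | h0
  · have b' : IsAxis (z * x * z⁻¹)⁻¹ (-c) l := ⟨by omega, a.line, fun t => by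
      rw [inv_mul_eq_iff_eq_mul, hc]; congr 1; ring⟩
    have e := b'.unique b.rev
    have : (z * x * z⁻¹)⁻¹ = x := by
      refine mul_right_cancel (b := l 0) ?_
      rw [b'.map, a.map, e.1]
    have h2 : Commute (z ^ 2) x := by
      have h3 : z * x * z⁻¹ = x⁻¹ := by rw [← this, inv_inv, this]
      have h4 : z * x⁻¹ * z⁻¹ = x := by
        calc z * x⁻¹ * z⁻¹ = (z * x * z⁻¹)⁻¹ := by group
          _ = x := this
      rw [Commute, SemiconjBy, ← mul_inv_eq_iff_eq_mul]
      calc z ^ 2 * x * (z ^ 2)⁻¹ = z * (z * x * z⁻¹) * z⁻¹ := by rw [pow_two]; group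
        _ = x := by rw [h3, h4]
    by_cases hz : z = 1
    · subst hz; exact Commute.one_left x
    · exact commute_trans (y := z ^ 2) (by simpa using hz) (Commute.self_pow z 2) h2
  · subst h0
    have : z * x * z⁻¹ = 1 := mul_right_cancel (b := l 0) (by rw [hc]; simp)
    exact absurd this b.ne_one
  · have b' : IsAxis (z * x * z⁻¹) c l := ⟨h0, a.line, hc⟩
    have e := b'.unique b
    have : z * x * z⁻¹ = x := by
      refine mul_right_cancel (b := l 0) ?_
      rw [b'.map, a.map, e.1]
    rw [Commute, SemiconjBy, ← mul_inv_eq_iff_eq_mul, this]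

theorem exists_zpowers_of_commute (H : Subgroup (FreeGroup α))
    (hH : ∀ x ∈ H, ∀ y ∈ H, Commute x y) : ∃ g, H = Subgroup.zpowers g := by
  by_cases hbot : H = ⊥
  · exact ⟨1, by simp [hbot]⟩
  obtain ⟨y, hy, hy1⟩ := H.bot_or_exists_ne_one.resolve_left hbot
  obtain ⟨l, a⟩ := exists_isAxis hy1
  choose c hc using fun x : H => a.exists_translation (hH x.1 x.2 y hy)
  let f : H →* Multiplicative ℤ := MonoidHom.mk' (fun x => Multiplicative.ofAdd (c x)) (by
    intro x z
    rw [← ofAdd_add]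
    congr 1
    apply a.line.inj
    have := hc (x * z) 0
    rw [Subgroup.coe_mul, mul_assoc, hc, hc, zero_add, zero_add] at this
    rw [← this, add_comm])
  have hf : Function.Injective f := by
    intro x z h
    have h' : c x = c z := h
    apply Subtype.ext
    exact mul_right_cancel (b := l 0) (by rw [hc, hc, h'])
  have := isCyclic_of_injective f hf
  obtain ⟨g, hg⟩ := this
  refine ⟨g, ?_⟩
  ext x
  constructor
  · intro hx
    obtain ⟨k, hk⟩ := hg ⟨x, hx⟩
    exact ⟨k, by simpa using congrArg Subtype.val hk⟩
  · rintro ⟨k, rfl⟩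
    exact (g ^ k).2

end FreeGroup

/-- The partial products of `u ^ M 0 * P 0 * u ^ M 1 * P 1 * ⋯`. -/
def chainProd {G : Type*} [Group G] (u : G) (P : ℕ → G) (M : ℕ → ℕ) : ℕ → G
  | 0 => 1
  | i + 1 => chainProd u P M i * u ^ M i * P i

theorem chainProd_add {G : Type*} [Group G] {u : G} {P : ℕ → G} {M : ℕ → ℕ} {m : ℕ}
    (hP : ∀ i, P (i + m) = P i) (hM : ∀ i, M (i + m) = M i) (i : ℕ) :
    chainProd u P M (i + m) = chainProd u P M m * chainProd u P M i := by
  induction i with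
  | zero => simp [chainProd]
  | succ i ih =>
    rw [show i + 1 + m = i + m + 1 by ring, chainProd, ih, hP, hM, chainProd]
    simp only [mul_assoc]

theorem map_chainProd {G H : Type*} [Group G] [Group H] (f : G →* H) (u : G) (P : ℕ → G)
    (M : ℕ → ℕ) (i : ℕ) : f (chainProd u P M i) = chainProd (f u) (fun i => f (P i)) M i := by
  induction i with
  | zero => simp [chainProd]
  | succ i ih => simp [chainProd, ih]

namespace FreeGroup

variable {α : Type*} [DecidableEq α]

section Junction

variable {u P : FreeGroup α} {L σ : ℤ} {l : ℤ → FreeGroup α} {C : ℕ}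

theorem wdist_ne_of_not_commute (a : IsAxis u L l) (hP : wdist (l 0) (P * l 0) ≤ C * L)
    (hc : ¬ Commute P u) (hσ : σ = (C + 3) * L) {t : ℤ} (ht : 0 ≤ t) :
    wdist (l 0) (P * l t) ≠ σ + wdist (l (-σ)) (P * l t) := by
  intro h
  have hL := a.pos
  have hσ' : σ = C * L + 3 * L := by rw [hσ]; ring
  have hCL : 0 ≤ C * L := by positivity
  have key : ∀ i, C * L < i → i ≤ σ → l (-i) = P * l (i + t - wdist (l 0) (P * l t)) := by
    intro i h1 h2
    have e1 := a.line 0 (-i)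
    have e2 := a.line 0 (-σ)
    have e3 := a.line (-i) (-σ)
    have t1 := wdist_triangle (l 0) (l (-i)) (P * l t)
    have t2 := wdist_triangle (l (-i)) (l (-σ)) (P * l t)
    have e4 : wdist (P * l 0) (P * l t) = t := by rw [wdist_mul_left, a.line]; omega
    have f1 := wdist_four_point (l 0) (P * l t) (l (-i)) (P * l 0)
    have f2 := wdist_four_point (P * l 0) (P * l t) (l (-i)) (l 0)
    have t3 := wdist_triangle (l 0) (P * l 0) (l (-i))
    have t4 := wdist_triangle (P * l 0) (l (-i)) (P * l t)
    have c1 := wdist_comm (P * l 0) (l (-i))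
    have c2 := wdist_comm (P * l 0) (P * l t)
    have c3 := wdist_comm (P * l 0) (l 0)
    have c4 := wdist_comm (P * l t) (l (-i))
    have c5 := wdist_comm (P * l t) (l 0)
    have c6 := wdist_comm (l (-i)) (l 0)
    have hd : wdist (P * l 0) (l (-i)) = i + t - wdist (l 0) (P * l t) := by omega
    have := IsLine.eq_of_between (l := fun t => P * l t)
      (fun s t => by rw [wdist_mul_left, a.line]) (x := l (-i)) (s := 0) (t := t)
      (by omega)
    rw [zero_add, hd] at this
    exact this
  have k1 := key (C * L + L) (by omega) (by omega)
  have k2 := key (C * L + L + L) (by omega) (by omega)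
  have : P * u * P⁻¹ = u⁻¹ := by
    refine mul_right_cancel (b := l (-(C * L + L))) ?_
    rw [a.inv_mul, show -(C * L + L) - L = -(C * L + L + L) by ring, k2, k1]
    rw [show C * L + L + L + t - wdist (l 0) (P * l t) = C * L + L + t - wdist (l 0) (P * l t) + L
      by ring, ← a.map]
    group
  exact hc (commute_of_commute_conj a.ne_one (by rw [this]; exact (Commute.refl u).inv_right))

theorem wdist_junction (a : IsAxis u L l) (hP : wdist (l 0) (P * l 0) ≤ C * L)
    (hc : ¬ Commute P u) (hσ : σ = (C + 3) * L) {s t : ℤ} (hs : σ ≤ s) (ht : 0 ≤ t) :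
    wdist (l (-s)) (P * l t) = wdist (l (-s)) (l (-σ)) + wdist (l (-σ)) (P * l t) := by
  have h := wdist_ne_of_not_commute a hP hc hσ ht
  have hσ0 : 0 < σ := by rw [hσ]; have := a.pos; positivity
  have e1 := a.line (-s) (-σ)
  have e2 := a.line 0 (-σ)
  have e3 := a.line 0 (-s)
  have e4 := a.line (-σ) (-s)
  have f := wdist_four_point (l 0) (l (-s)) (l (-σ)) (P * l t)
  have t1 := wdist_triangle (l 0) (l (-σ)) (P * l t)
  have t2 := wdist_triangle (l (-s)) (l (-σ)) (P * l t)
  have c := wdist_comm (l (-σ)) (l (-s))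
  omega

theorem wdist_junction' (a : IsAxis u L l) (hP : wdist (l 0) (P * l 0) ≤ C * L)
    (hc : ¬ Commute P u) (hσ : σ = (C + 3) * L) {s t : ℤ} (hs : σ ≤ s) (ht : t ≤ 0) :
    wdist (l t) (P * l s) = wdist (l t) (P * l σ) + wdist (P * l σ) (P * l s) := by
  have h1 := wdist_junction a.rev (P := P⁻¹) (C := C)
    (by simp only [neg_zero]; rw [← wdist_mul_left P, mul_inv_cancel_left, wdist_comm]; exact hP)
    (by simpa using hc) hσ hs (t := -t) (by omega)
  simp only [neg_neg] at h1
  rw [← wdist_mul_left P, mul_inv_cancel_left, ← wdist_mul_left P (l σ), mul_inv_cancel_left,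
    ← wdist_mul_left P (l s) (l σ), wdist_comm, wdist_comm (P * l s) (P * l σ),
    wdist_comm (P * l σ) (l t)] at h1
  omega

end Junction

/-- A periodic product of high powers of `u` separated by short elements that do not commute
with `u`. -/
structure IsConfig (C m : ℕ) (u : FreeGroup α) (P : ℕ → FreeGroup α) (M : ℕ → ℕ) (L : ℤ)
    (l : ℤ → FreeGroup α) : Prop where
  axis : IsAxis u L l
  disp : ∀ i, wdist (l 0) (P i * l 0) ≤ C * L
  ncomm : ∀ i, ¬ Commute (P i) u
  perP : ∀ i, P (i + m) = P i
  perM : ∀ i, M (i + m) = M i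
  m_pos : 0 < m
  le_M : ∀ i, 2 * (C + 3) + 1 ≤ M i

namespace IsConfig

variable {C m : ℕ} {u : FreeGroup α} {P : ℕ → FreeGroup α} {M : ℕ → ℕ} {L : ℤ}
  {l : ℤ → FreeGroup α}

/-- The axis of the product runs along translates of the axis of `u`. -/
theorem exists_axis (c : IsConfig C m u P M L l) : ∃ (γ : ℤ → FreeGroup α) (α : ℕ → ℤ),
    IsAxis (chainProd u P M m) (α m) γ ∧ α 0 = 0 ∧
    (∀ i, α i + (M i - 2 * (C + 3)) * L < α (i + 1)) ∧
    (∀ i, α (i + 1) ≤ α i + (M i - 2 * (C + 3)) * L + (3 * C + 6) * L) ∧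
    ∀ i t, 0 ≤ t → t ≤ (M i - 2 * (C + 3)) * L →
      γ (α i + t) = chainProd u P M i * l ((C + 3) * L + t) := by
  obtain ⟨σ, hσ⟩ : ∃ σ : ℤ, σ = (C + 3) * L := ⟨_, rfl⟩
  have a := c.axis
  have hL := a.pos
  have hσ0 : 0 < σ := by rw [hσ]; positivity
  set h := chainProd u P M with hh
  obtain ⟨b, hb⟩ : ∃ b : ℕ → ℤ, ∀ i, b i = (M i - 2 * (C + 3)) * L := ⟨_, fun _ => rfl⟩
  have hM : ∀ i, b i = M i * L - 2 * σ := fun i => by rw [hb, hσ]; ring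
  have hb0 : ∀ i, 0 < b i := fun i => by
    rw [hb]
    have : (2 * (C + 3) + 1 : ℤ) ≤ M i := by exact_mod_cast c.le_M i
    nlinarith
  have hsucc : ∀ i, h (i + 1) = h i * u ^ M i * P i := fun i => rfl
  -- the corners of the broken line
  let y : ℕ → FreeGroup α := fun j =>
    if j % 2 = 0 then h (j / 2) * l σ else h (j / 2) * u ^ M (j / 2) * l (-σ)
  have y0 : ∀ i, y (2 * i) = h i * l σ := fun i => by simp [y]
  have y1 : ∀ i, y (2 * i + 1) = h i * u ^ M i * l (-σ) := fun i => by
    simp only [y, Nat.mul_add_mod_self_left]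
    rw [show (2 * i + 1) / 2 = i by omega]
    simp
  have y2 : ∀ i, y (2 * i + 2) = h i * u ^ M i * (P i * l σ) := fun i => by
    rw [show 2 * i + 2 = 2 * (i + 1) by ring, y0, hsucc, mul_assoc]
  have y3 : ∀ i, y (2 * i + 3) = h i * u ^ M i * (P i * l (b (i + 1) + σ)) := fun i => by
    rw [show 2 * i + 3 = 2 * (i + 1) + 1 by ring, y1, hsucc, mul_assoc, mul_assoc, a.pow_mul,
      show -σ + M (i + 1) * L = b (i + 1) + σ by rw [hM]; ring]
  have y0' : ∀ i, y (2 * i) = h i * u ^ M i * l (-(b i + σ)) := fun i => by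
    rw [y0, mul_assoc, a.pow_mul]; congr 2; rw [hM]; ring
  have d0 : ∀ i, wdist (y (2 * i)) (y (2 * i + 1)) = b i := fun i => by
    rw [y0', y1, wdist_mul_left, a.line]; have := hb0 i; omega
  have d1 : ∀ i, wdist (y (2 * i + 1)) (y (2 * i + 2)) = wdist (l (-σ)) (P i * l σ) := fun i => by
    rw [y1, y2, wdist_mul_left]
  have e0 : ∀ i, 0 < wdist (l (-σ)) (P i * l σ) := fun i => wdist_pos fun e => by
    have := wdist_ne_of_not_commute a (c.disp i) (c.ncomm i) hσ (t := σ) hσ0.le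
    rw [← e, wdist_self, a.line] at this; omega
  have e1 : ∀ i, wdist (l (-σ)) (P i * l σ) ≤ (3 * C + 6) * L := fun i => by
    have t1 := wdist_triangle (l (-σ)) (l 0) (P i * l σ)
    have t2 := wdist_triangle (l 0) (P i * l 0) (P i * l σ)
    have t3 := c.disp i
    rw [wdist_mul_left, a.line] at t2
    rw [a.line] at t1
    have : (3 * C + 6) * L = C * L + 2 * σ := by rw [hσ]; ring
    omega
  have par : ∀ (p : ℕ → Prop), (∀ i, p (2 * i)) → (∀ i, p (2 * i + 1)) → ∀ j, p j := by
    intro p h0 h1 j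
    rcases Nat.even_or_odd' j with ⟨i, rfl | rfl⟩
    exacts [h0 i, h1 i]
  have pos : ∀ j, 0 < wdist (y j) (y (j + 1)) :=
    par _ (fun i => by rw [d0]; exact hb0 i) (fun i => by rw [d1]; exact e0 i)
  have align : ∀ j, wdist (y j) (y (j + 2)) =
      wdist (y j) (y (j + 1)) + wdist (y (j + 1)) (y (j + 2)) := by
    refine par _ (fun i => ?_) (fun i => ?_)
    · rw [y0', y1, y2]
      simp only [wdist_mul_left]
      exact wdist_junction a (c.disp i) (c.ncomm i) hσ (by have := hb0 i; omega) hσ0.le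
    · rw [show 2 * i + 1 + 2 = 2 * i + 3 by ring, show 2 * i + 1 + 1 = 2 * i + 2 by ring,
        y1, y2, y3]
      simp only [wdist_mul_left]
      have := wdist_junction' a (c.disp i) (c.ncomm i) hσ (s := b (i + 1) + σ) (t := -σ)
        (by have := hb0 (i + 1); omega) (by omega)
      rwa [wdist_mul_left] at this
  have chain := fun {i j k : ℕ} => wdist_chain y pos align (i := i) (j := j) (k := k)
  have yper : ∀ i, y (2 * (i + m)) = h m * y (2 * i) := fun i => by
    rw [y0, y0, hh, chainProd_add c.perP c.perM, mul_assoc]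
  have hg : h m ≠ 1 := by
    intro e
    have h1 := yper 0
    rw [e, one_mul] at h1
    have h2 := chain (i := 0) (j := 1) (k := 2 * (0 + m)) (by omega) (by have := c.m_pos; omega)
    rw [h1, wdist_self] at h2
    have := pos 0
    have := wdist_nonneg (y 1) (y (2 * 0))
    simp only [zero_add] at *
    omega
  have yd : wdist (y 0) (y (2 * m)) = wdist (y 0) (h m * y 0) := by
    rw [show y (2 * m) = h m * y 0 by simpa using yper 0]
  obtain ⟨γ', hγ'⟩ := exists_isAxis hg
  obtain ⟨p, hp⟩ := hγ'.exists_eq_of_wdist_sq (x := y 0) (by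
    have h1 := yper 0
    have h2 := yper m
    simp only [zero_add, mul_zero] at h1
    rw [h1] at h2
    rw [← h2, ← h1]
    have := chain (i := 0) (j := 2 * m) (k := 2 * (m + m)) (by omega) (by omega)
    rw [this, h2, h1, wdist_mul_left]; ring)
  have aγ := hγ'.shift p
  have hα : tlen (h m) = wdist (y 0) (y (2 * m)) := by
    rw [yd, hp, hγ'.map, hγ'.line]; have := hγ'.pos; omega
  rw [hα] at aγ
  have ypow : ∀ k : ℕ, y (2 * (k * m)) = γ' (k * wdist (y 0) (y (2 * m)) + p) := fun k => by
    induction k with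
    | zero => simpa using hp
    | succ k ih =>
      rw [show (k + 1) * m = k * m + m by ring, yper, ih, aγ.map]; congr 1; push_cast; ring
  have yγ : ∀ i, y (2 * i) = γ' (wdist (y 0) (y (2 * i)) + p) := fun i => by
    have h1 : i ≤ i * m := Nat.le_mul_of_pos_right i c.m_pos
    have h2 := chain (i := 0) (j := 2 * i) (k := 2 * (i * m)) (by omega) (by omega)
    have h3 : wdist (y 0) (y (2 * (i * m))) = i * wdist (y 0) (y (2 * m)) := by
      rw [ypow i]
      generalize hD : wdist (y 0) (y (2 * m)) = D
      have : 0 ≤ i * D := by have := wdist_nonneg (y 0) (y (2 * m)); rw [hD] at this; positivity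
      rw [hp, hγ'.line]
      omega
    have := aγ.line.eq_of_between (x := y (2 * i)) (s := 0) (t := i * wdist (y 0) (y (2 * m)))
    simp only [zero_add] at this
    rw [← hp, ← ypow] at this
    exact this (by omega)
  refine ⟨_, fun i => wdist (y 0) (y (2 * i)), aγ, by simp, fun i => ?_, fun i => ?_,
    fun i t h0 ht => ?_⟩
  · have h1 := chain (i := 0) (j := 2 * i) (k := 2 * (i + 1)) (by omega) (by omega)
    have h2 := align (2 * i)
    have h3 := e0 i
    rw [d0, d1] at h2
    rw [← hb]
    change wdist (y 0) (y (2 * i)) + _ < wdist (y 0) (y (2 * i + 2))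
    change wdist (y 0) (y (2 * i + 2)) = _ + wdist (y (2 * i)) (y (2 * i + 2)) at h1
    omega
  · have h1 := chain (i := 0) (j := 2 * i) (k := 2 * (i + 1)) (by omega) (by omega)
    have h2 := align (2 * i)
    have h3 := e1 i
    rw [d0, d1] at h2
    rw [← hb]
    change wdist (y 0) (y (2 * i + 2)) ≤ wdist (y 0) (y (2 * i)) + _ + _
    change wdist (y 0) (y (2 * i + 2)) = _ + wdist (y (2 * i)) (y (2 * i + 2)) at h1
    omega
  · rw [← hb] at ht
    rw [← hσ]
    have h1 := chain (i := 0) (j := 2 * i) (k := 2 * (i + 1)) (by omega) (by omega)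
    have h2 := align (2 * i)
    have e1 : wdist (y (2 * i)) (h i * l (σ + t)) = t := by
      rw [y0, wdist_mul_left, a.line]; omega
    have e2 : wdist (h i * l (σ + t)) (y (2 * i + 1)) = b i - t := by
      rw [y1, mul_assoc, a.pow_mul, wdist_mul_left, a.line, show -σ + M i * L = b i + σ by
        rw [hM]; ring]; omega
    have t1 := wdist_triangle (h i * l (σ + t)) (y (2 * i + 1)) (y (2 * i + 2))
    have t2 := wdist_triangle (y (2 * i)) (h i * l (σ + t)) (y (2 * i + 2))
    have d0i := d0 i
    have := aγ.line.eq_of_between (x := h i * l (σ + t)) (s := wdist (y 0) (y (2 * i)))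
      (t := wdist (y 0) (y (2 * (i + 1))))
    simp only [← yγ] at this
    rw [show 2 * (i + 1) = 2 * i + 2 by ring] at *
    have := this (by omega)
    rw [e1] at this
    exact this.symm

end IsConfig

/-- `v` translates the part of the path `γ` between times `a` and `b` by `L`. -/
def Shifts (γ : ℤ → FreeGroup α) (v : FreeGroup α) (L a b : ℤ) : Prop :=
  ∀ t, a ≤ t → t + L ≤ b → v * γ t = γ (t + L)

omit [DecidableEq α] in
theorem Shifts.commute {γ : ℤ → FreeGroup α} {v v' : FreeGroup α} {L L' a a' b b' : ℤ} (p : ℤ)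
    (hv : Shifts γ v L a b) (hv' : Shifts γ v' L' a' b') (hL : 0 ≤ L) (hL' : 0 ≤ L')
    (h1 : a ≤ p) (h2 : a' ≤ p) (h3 : p + L + L' ≤ b) (h4 : p + L + L' ≤ b') : Commute v v' :=
  commute_of_translations (hv p h1 (by omega)) (hv' p h2 (by omega)) (hv _ (by omega) (by omega))
    (hv' _ (by omega) (by omega))

/-- Two sequences of consecutive segments of a line, translated by elements no two consecutive
of which commute, stay synchronized. -/
theorem commute_of_synchronized {γ : ℤ → FreeGroup α} {v v' : ℕ → FreeGroup α} {L L' Q : ℤ}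
    {x x' a a' : ℕ → ℤ} (hL : 0 < L) (hL' : 0 < L')
    (hv : ∀ i, Shifts γ (v i) L (x i) (x i + a i))
    (hv' : ∀ i, Shifts γ (v' i) L' (x' i) (x' i + a' i))
    (hx : ∀ i, x i + a i < x (i + 1)) (hx' : ∀ i, x' i + a' i < x' (i + 1))
    (hxQ : ∀ i, x (i + 1) ≤ x i + a i + Q) (hxQ' : ∀ i, x' (i + 1) ≤ x' i + a' i + Q)
    (ha : ∀ i, 2 * (L + L') + Q ≤ a i) (ha' : ∀ i, 2 * (L + L') + Q ≤ a' i)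
    (h1 : ∀ i, v i ≠ 1) (h1' : ∀ i, v' i ≠ 1)
    (hc : ∀ i, ¬ Commute (v i) (v (i + 1))) (hc' : ∀ i, ¬ Commute (v' i) (v' (i + 1)))
    (h0 : max (x 0) (x' 0) + L + L' ≤ min (x 0 + a 0) (x' 0 + a' 0)) (i : ℕ) :
    Commute (v i) (v' i) := by
  have inv : max (x i) (x' i) + L + L' ≤ min (x i + a i) (x' i + a' i) := by
    induction i with
    | zero => exact h0
    | succ i ih =>
      have cc := (hv i).commute (max (x i) (x' i)) (hv' i) hL.le hL'.le (by omega) (by omega)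
        (by omega) (by omega)
      have b1 : x' i + a' i < x (i + 1) + L + L' := by
        by_contra! hlt
        refine hc i (commute_trans (h1' i) cc ?_)
        have := hx i; have := ha (i + 1); have := hxQ i
        exact ((hv (i + 1)).commute (x (i + 1)) (hv' i) hL.le hL'.le (by omega) (by omega)
          (by omega) (by omega)).symm
      have b2 : x i + a i < x' (i + 1) + L + L' := by
        by_contra! hlt
        refine hc' i (commute_trans (h1 i) cc.symm ?_)
        have := hx' i; have := ha' (i + 1); have := hxQ' i
        exact ((hv i).commute (x' (i + 1)) (hv' (i + 1)) hL.le hL'.le (by omega) (by omega)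
          (by omega) (by omega))
      have := hx i; have := ha (i + 1); have := hxQ i
      have := hx' i; have := ha' (i + 1); have := hxQ' i
      omega
  exact (hv i).commute (max (x i) (x' i)) (hv' i) hL.le hL'.le (by omega) (by omega) (by omega)
    (by omega)

theorem exists_two_mul_sub_le (d : ℤ) {A : ℤ} (hA : 0 < A) :
    ∃ k : ℤ, -A ≤ 2 * (d + k * A) ∧ 2 * (d + k * A) ≤ A := by
  refine ⟨-((2 * d + A) / (2 * A)), ?_⟩
  have h1 := Int.emod_add_mul_ediv (2 * d + A) (2 * A)
  have h2 := Int.emod_nonneg (2 * d + A) (b := 2 * A) (by omega)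
  have h3 := Int.emod_lt_of_pos (2 * d + A) (b := 2 * A) (by omega)
  constructor <;> nlinarith

namespace IsConfig

variable {C m : ℕ} {u : FreeGroup α} {P : ℕ → FreeGroup α} {M : ℕ → ℕ} {L : ℤ}
  {l : ℤ → FreeGroup α}

theorem pos_b (c : IsConfig C m u P M L l) (i : ℕ) : L ≤ (M i - 2 * (C + 3)) * L := by
  have : (2 * (C + 3) + 1 : ℤ) ≤ M i := by exact_mod_cast c.le_M i
  have := c.axis.pos
  nlinarith

theorem shifts (c : IsConfig C m u P M L l) {γ : ℤ → FreeGroup α} {x : ℤ} {i : ℕ}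
    (h : ∀ t, 0 ≤ t → t ≤ (M i - 2 * (C + 3)) * L →
      γ (x + t) = chainProd u P M i * l ((C + 3) * L + t)) :
    Shifts γ (chainProd u P M i * u * (chainProd u P M i)⁻¹) L x
      (x + (M i - 2 * (C + 3)) * L) := by
  intro t h1 h2
  have hL := c.axis.pos
  have e1 := h (t - x) (by omega) (by omega)
  have e2 := h (t - x + L) (by omega) (by omega)
  rw [add_sub_cancel] at e1
  rw [show x + (t - x + L) = t + L by ring, ← add_assoc, ← c.axis.map] at e2
  rw [e1, e2]; group

theorem tlen_lt (c : IsConfig C m u P M L l) :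
    (M 0 - 2 * (C + 3)) * L < tlen (chainProd u P M m) := by
  obtain ⟨γ, x, aγ, h0, h1, -, -⟩ := c.exists_axis
  have mono : StrictMono x := strictMono_nat_of_lt_succ fun i => by
    have := h1 i; have := c.pos_b i; have := c.axis.pos; omega
  rw [aγ.tlen_eq]
  have := mono.monotone (show 1 ≤ m from c.m_pos)
  have := h1 0
  rw [h0] at this
  simp only [zero_add] at this
  omega

theorem ne_one (c : IsConfig C m u P M L l) : chainProd u P M m ≠ 1 := by
  obtain ⟨γ, x, aγ, -⟩ := c.exists_axis
  exact aγ.ne_one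

theorem not_commute_succ (c : IsConfig C m u P M L l) (i : ℕ) :
    ¬ Commute (chainProd u P M i * u * (chainProd u P M i)⁻¹)
      (chainProd u P M (i + 1) * u * (chainProd u P M (i + 1))⁻¹) := by
  intro h
  rw [← Commute.conj_iff (chainProd u P M i * u ^ M i)⁻¹] at h
  have e1 : (chainProd u P M i * u ^ M i)⁻¹ * (chainProd u P M i * u * (chainProd u P M i)⁻¹) *
      (chainProd u P M i * u ^ M i)⁻¹⁻¹ = u := by
    calc _ = (u ^ M i)⁻¹ * (u * u ^ M i) := by group
      _ = (u ^ M i)⁻¹ * (u ^ M i * u) := by rw [← pow_succ, ← pow_succ']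
      _ = u := by group
  have e2 : (chainProd u P M i * u ^ M i)⁻¹ * (chainProd u P M (i + 1) * u *
      (chainProd u P M (i + 1))⁻¹) * (chainProd u P M i * u ^ M i)⁻¹⁻¹ = P i * u * (P i)⁻¹ := by
    rw [chainProd]; group
  rw [e1, e2] at h
  exact c.ncomm i (commute_of_commute_conj c.axis.ne_one h)

theorem not_commute (c : IsConfig C m u P M L l) : ¬ Commute (chainProd u P M m) u := by
  intro h
  obtain ⟨γ, x, aγ, h0, -, -, h3⟩ := c.exists_axis
  have s0 := c.shifts (h3 0)
  have s1 := c.shifts (h3 1)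
  obtain ⟨d, hd⟩ := aγ.exists_translation h.symm
  have hL := c.axis.pos
  have e0 := s0 (x 0) le_rfl (by have := c.pos_b 0; omega)
  have e1 := s1 (x 1) le_rfl (by have := c.pos_b 1; omega)
  have hu : chainProd u P M 0 * u * (chainProd u P M 0)⁻¹ = u := by simp [chainProd]
  rw [hu, hd] at e0
  have hdL := aγ.line.inj e0
  have e2 : chainProd u P M 1 * u * (chainProd u P M 1)⁻¹ = u := by
    refine mul_right_cancel (b := γ (x 1)) ?_
    rw [e1, hd]; congr 1; omega
  exact c.not_commute_succ 0 (by rw [hu, e2])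

end IsConfig

/-- A configuration whose first exponent is much larger than the others. -/
structure IsBigConfig (C N T m : ℕ) (u : FreeGroup α) (P : ℕ → FreeGroup α) (M : ℕ → ℕ) (L : ℤ)
    (l : ℤ → FreeGroup α) : Prop extends IsConfig C m u P M L l where
  M_zero : M 0 = T
  M_mem : ∀ i, 0 < i → i < m → N ≤ M i ∧ M i ≤ 2 * N
  le_N : 11 * C + 30 ≤ N
  le_T : m * (2 * N + 3 * C + 6) + 4 * C + 18 ≤ T

namespace IsBigConfig

variable {C N T m : ℕ} {u u' : FreeGroup α} {P P' : ℕ → FreeGroup α} {M M' : ℕ → ℕ} {L L' : ℤ}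
  {l l' : ℤ → FreeGroup α}

theorem N_le (c : IsBigConfig C N T m u P M L l) (i : ℕ) : N ≤ M i := by
  have hper : ∀ k j, M (j + k * m) = M j := by
    intro k j
    induction k with
    | zero => simp
    | succ k ih => rw [show j + (k + 1) * m = j + k * m + m by ring, c.perM, ih]
  have hm := c.m_pos
  rw [← Nat.mod_add_div i m, mul_comm m, hper]
  rcases Nat.eq_zero_or_pos (i % m) with h | h
  · rw [h, c.M_zero]
    have := c.le_T
    nlinarith
  · exact (c.M_mem _ h (Nat.mod_lt _ hm)).1

theorem bounds (c : IsBigConfig C N T m u P M L l) :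
    (T - 2 * (C + 3)) * L < tlen (chainProd u P M m) ∧
      tlen (chainProd u P M m) ≤ (T + m * (2 * N + 3 * C + 6)) * L := by
  have hL := c.axis.pos
  refine ⟨by rw [← c.M_zero]; exact c.tlen_lt, ?_⟩
  obtain ⟨γ, x, aγ, h0, -, h2, -⟩ := c.exists_axis
  have key : ∀ i, 1 ≤ i → i ≤ m → x i ≤ (T + i * (2 * N + 3 * C + 6)) * L := by
    intro i h1
    induction i, h1 using Nat.le_induction with
    | base =>
      intro _
      have := h2 0
      rw [h0, c.M_zero] at this
      simp only [zero_add] at this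
      push_cast
      nlinarith
    | succ i hi ih =>
      intro him
      have h3 := ih (by omega)
      have h4 := h2 i
      have h5 : (M i : ℤ) ≤ 2 * N := by exact_mod_cast (c.M_mem i (by omega) (by omega)).2
      push_cast
      nlinarith
  rw [aγ.tlen_eq]
  exact key m c.m_pos le_rfl

theorem exists_zpow_of_commute (c : IsBigConfig C N T m u P M L l) {ρ : FreeGroup α}
    (h : Commute ρ (chainProd u P M m)) : ∃ k : ℤ, ρ = chainProd u P M m ^ k := by
  have hb := c.bounds
  have hT := c.le_T
  have hL := c.axis.pos
  obtain ⟨γ, x, aγ, h0, -, -, h3⟩ := c.exists_axis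
  obtain ⟨d, hd⟩ := aγ.exists_translation h
  obtain ⟨k, hk1, hk2⟩ := exists_two_mul_sub_le d aγ.pos
  have s0 := c.shifts (h3 0)
  have hu : chainProd u P M 0 * u * (chainProd u P M 0)⁻¹ = u := by simp [chainProd]
  rw [hu, h0, c.M_zero, zero_add] at s0
  rw [aγ.tlen_eq] at hb
  set g := chainProd u P M m
  have hρ : ∀ t, g ^ k * ρ * γ t = γ (t + (d + k * x m)) := fun t => by
    rw [mul_assoc, hd, aγ.zpow_mul]; congr 1; ring
  have hTz : (m * (2 * N + 3 * C + 6) + 4 * C + 18 : ℤ) ≤ T := by exact_mod_cast hT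
  have hB : x m + 2 * L ≤ 2 * ((T - 2 * (C + 3)) * L) := by nlinarith
  generalize d + k * x m = e at *
  generalize (T - 2 * (C + 3) : ℤ) * L = B at *
  have cu : Commute (g ^ k * ρ) u := by
    rcases le_total 0 e with he | he
    · exact commute_of_translations (hρ 0) (s0 _ le_rfl (by omega)) (hρ _)
        (s0 _ (by omega) (by omega))
    · exact commute_of_translations (hρ (-e)) (s0 _ (by omega) (by omega)) (hρ _)
        (s0 _ (by omega) (by omega))
  have cg : Commute (g ^ k * ρ) g := (Commute.self_zpow g k).symm.mul_left h
  refine ⟨-k, ?_⟩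
  have h1 : g ^ k * ρ = 1 := by
    by_contra hne
    exact c.not_commute (commute_trans hne cg.symm cu)
  rw [zpow_neg]
  exact eq_inv_of_mul_eq_one_right h1

theorem base_le (c : IsBigConfig C N T m u P M L l) (c' : IsBigConfig C N T m u' P' M' L' l')
    (h : chainProd u P M m = chainProd u' P' M' m) : L ≤ 2 * L' := by
  have h1 := c.bounds.1
  have h2 := c'.bounds.2
  rw [← h] at h2
  have hT : (m * (2 * N + 3 * C + 6) + 4 * C + 18 : ℤ) ≤ T := by exact_mod_cast c.le_T
  have hH : (0 : ℤ) ≤ m * (2 * N + 3 * C + 6) := by positivity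
  generalize (m * (2 * N + 3 * C + 6) : ℤ) = H at *
  have hC : (0 : ℤ) ≤ C := by positivity
  by_contra! hlt
  have e1 := mul_pos (show (0 : ℤ) < T - 2 * (C + 3) by linarith) (sub_pos.2 hlt)
  have e2 := mul_nonneg (show (0 : ℤ) ≤ T - H - 4 * C - 12 by linarith) c'.axis.pos.le
  linarith

/-- If two configurations have the same product then, after conjugating one of them by a power of
that product, their corresponding subwords differ by elements commuting with the base. -/
theorem decode (c : IsBigConfig C N T m u P M L l) (c' : IsBigConfig C N T m u' P' M' L' l')
    (h : chainProd u P M m = chainProd u' P' M' m) :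
    ∃ (k : ℤ) (s : FreeGroup α) (z : ℕ → FreeGroup α), s = chainProd u P M m ^ k ∧
      z 0 = 1 ∧ z m = 1 ∧ Commute u (s * u' * s⁻¹) ∧ (∀ i, Commute (z i) u) ∧
      ∀ i, s * P' i * s⁻¹ =
        ((s * u' * s⁻¹) ^ M' i)⁻¹ * (z i)⁻¹ * u ^ M i * P i * z (i + 1) := by
  have hb := c.bounds
  have hb' := c'.bounds
  have hT := c.le_T
  have hN := c.le_N
  have hL := c.axis.pos
  have hL' := c'.axis.pos
  have hLL := c.base_le c' h
  have hLL' := c'.base_le c h.symm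
  obtain ⟨γ, x, aγ, h0, h1, h2, h3⟩ := c.exists_axis
  obtain ⟨γ', x', aγ', h0', h1', h2', h3'⟩ := c'.exists_axis
  have s1 := fun i => c.shifts (h3 i)
  have s1' := fun i => c'.shifts (h3' i)
  have hne := c.not_commute_succ
  have hne' := c'.not_commute_succ
  rw [← h] at aγ' hb'
  obtain ⟨hx, d, hd⟩ := aγ.unique aγ'
  obtain ⟨k, hk1, hk2⟩ := exists_two_mul_sub_le d aγ.pos
  rw [aγ.tlen_eq] at hb hb'
  set g := chainProd u P M m with hg
  obtain ⟨s, hs⟩ : ∃ s, s = g ^ k := ⟨_, rfl⟩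
  have hsγ : ∀ t, γ t = s * γ' (t - (d + k * x m)) := fun t => by
    rw [hd, hs, aγ.zpow_mul]; congr 1; ring
  generalize d + k * x m = e at *
  have s2 : ∀ i, Shifts γ (s * (chainProd u' P' M' i * u' * (chainProd u' P' M' i)⁻¹) * s⁻¹) L'
      (x' i + e) (x' i + e + (M' i - 2 * (C + 3)) * L') := by
    intro i t t1 t2
    have := s1' i (t - e) (by omega) (by omega)
    rw [hsγ t, hsγ (t + L'), show t + L' - e = t - e + L' by ring, ← this]; group
  have hTz : (m * (2 * N + 3 * C + 6) + 4 * C + 18 : ℤ) ≤ T := by exact_mod_cast hT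
  have hNz : (11 * C + 30 : ℤ) ≤ N := by exact_mod_cast hN
  have hM : ∀ i, (N : ℤ) ≤ M i := fun i => by exact_mod_cast c.N_le i
  have hM' : ∀ i, (N : ℤ) ≤ M' i := fun i => by exact_mod_cast c'.N_le i
  have hC : (0 : ℤ) ≤ C := by positivity
  have len : (2 * (L + L') + (3 * C + 6) * (L + L') : ℤ) ≤ (N - 2 * (C + 3)) * L := by
    calc _ = (3 * C + 8) * (L + L') := by ring
      _ ≤ (3 * C + 8) * (3 * L) := by gcongr; linarith
      _ = (9 * C + 24) * L := by ring
      _ ≤ _ := by gcongr; linarith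
  have len' : (2 * (L + L') + (3 * C + 6) * (L + L') : ℤ) ≤ (N - 2 * (C + 3)) * L' := by
    calc _ = (3 * C + 8) * (L + L') := by ring
      _ ≤ (3 * C + 8) * (3 * L') := by gcongr; linarith
      _ = (9 * C + 24) * L' := by ring
      _ ≤ _ := by gcongr; linarith
  have gap : ((3 * C + 6) * L : ℤ) ≤ (3 * C + 6) * (L + L') := by gcongr; linarith
  have gap' : ((3 * C + 6) * L' : ℤ) ≤ (3 * C + 6) * (L + L') := by gcongr; linarith
  have sync := commute_of_synchronized hL hL' s1 s2 h1 (fun i => by have := h1' i; omega)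
    (Q := (3 * C + 6) * (L + L')) (fun i => by have := h2 i; linarith)
    (fun i => by have := h2' i; linarith)
    (fun i => len.trans (by have := hM i; gcongr))
    (fun i => len'.trans (by have := hM' i; gcongr))
    (fun i hi => c.axis.ne_one (by simpa using hi))
    (fun i hi => c'.axis.ne_one (by simpa using hi))
    hne (fun i hi => hne' i ((Commute.conj_iff s).1 hi))
    (by
      rw [h0, h0', c.M_zero, c'.M_zero]
      have hH : (0 : ℤ) ≤ m * (2 * N + 3 * C + 6) := by positivity
      generalize (m * (2 * N + 3 * C + 6) : ℤ) = H at *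
      have B0 : (0 : ℤ) ≤ T - H - 4 * C - 18 := by linarith
      have B1 : 3 * L + 3 * L + x m ≤ 2 * ((T - 2 * (C + 3)) * L) := by
        linarith [hb.2, mul_nonneg B0 hL.le]
      have B2 : 3 * L' + 3 * L' + x m ≤ 2 * ((T - 2 * (C + 3)) * L') := by
        linarith [hb'.2, mul_nonneg B0 hL'.le]
      have := aγ.pos
      generalize (T - 2 * (C + 3) : ℤ) * L = B at *
      generalize (T - 2 * (C + 3) : ℤ) * L' = B' at *
      omega)
  have cu : Commute u (s * u' * s⁻¹) := by simpa [chainProd] using sync 0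
  refine ⟨k, s, fun i => (chainProd u P M i)⁻¹ * (s * chainProd u' P' M' i * s⁻¹), hs,
    by simp [chainProd], ?_, cu, fun i => ?_, fun i => ?_⟩
  · simp only
    rw [← h, ← hg, hs]; group
  · have h1 := (Commute.conj_iff (chainProd u P M i)⁻¹).2 (sync i)
    set z := (chainProd u P M i)⁻¹ * (s * chainProd u' P' M' i * s⁻¹) with hz
    have e1 : (chainProd u P M i)⁻¹ * (chainProd u P M i * u * (chainProd u P M i)⁻¹) *
      (chainProd u P M i)⁻¹⁻¹ = u := by group
    have e2 : (chainProd u P M i)⁻¹ * (s * (chainProd u' P' M' i * u' *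
      (chainProd u' P' M' i)⁻¹) * s⁻¹) * (chainProd u P M i)⁻¹⁻¹ =
      z * (s * u' * s⁻¹) * z⁻¹ := by rw [hz]; group
    rw [e1, e2] at h1
    refine commute_of_commute_conj c.axis.ne_one (commute_trans ?_ h1
      ((Commute.conj_iff z).2 cu.symm))
    intro hi
    exact c'.axis.ne_one (by simpa using hi)
  · rw [conj_pow]
    simp only [chainProd]
    group

end IsBigConfig

theorem eq_of_mul_mul_eq {u P ζ ζ' z z' : FreeGroup α} (hu : u ≠ 1) (hP : ¬ Commute P u)
    (h1 : Commute ζ u) (h2 : Commute ζ' u) (h3 : Commute z u) (h4 : Commute z' u)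
    (h : ζ * P * z = ζ' * P * z') : ζ = ζ' ∧ z = z' := by
  have key : ζ'⁻¹ * ζ = 1 := by
    by_contra hne
    have c1 : Commute (ζ'⁻¹ * ζ) u := (h2.inv_left).mul_left h1
    have c2 : Commute (z' * z⁻¹) u := h4.mul_left h3.inv_left
    have e : P * (z' * z⁻¹) * P⁻¹ = ζ'⁻¹ * ζ := by
      have : ζ = ζ' * P * z' * z⁻¹ * P⁻¹ := by rw [← h]; group
      rw [this]; group
    have c3 := (Commute.conj_iff P).2 c2
    rw [e] at c3
    exact hP (commute_of_commute_conj hu (commute_trans hne c1.symm c3))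
  have hζ : ζ = ζ' := (inv_mul_eq_one.1 key).symm
  exact ⟨hζ, by rw [hζ] at h; exact mul_left_cancel h⟩

theorem wdist_sq_le (u o : FreeGroup α) : wdist o (u * (u * o)) ≤ wdist o (u * o) + tlen u := by
  by_cases hu : u = 1
  · simp [hu]
  obtain ⟨l, a⟩ := exists_isAxis hu
  obtain ⟨s, hs⟩ := a.line.exists_proj o
  have h1 := a.wdist_mul hs
  have h2 := (a.pow (k := 2) (by norm_num)).wdist_mul hs
  rw [pow_two, mul_assoc] at h2
  push_cast at h2
  omega

theorem le_tlen_mul {a b o : FreeGroup α}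
    (h1 : 2 * wdist o (a * o) < wdist o (a * (b * o)) + wdist o (b * (a * o)))
    (h2 : 2 * wdist o (b * o) < wdist o (a * (b * o)) + wdist o (b * (a * o))) :
    wdist o (a * (b * o)) + wdist o (b * (a * o)) - wdist o (a * o) - wdist o (b * o) ≤
      tlen (a * b) := by
  have f1 := wdist_four_point o (a * (b * o)) (a * o) (a * (b * (a * o)))
  have f2 := wdist_four_point o (a * (b * (a * o))) (a * (b * o)) (a * (b * (a * (b * o))))
  have e := wdist_sq_le (a * b) o
  have c1 := wdist_comm (a * (b * o)) (a * o)
  have c2 := wdist_comm (a * (b * (a * o))) (a * (b * o))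
  simp only [mul_assoc, wdist_mul_left] at *
  omega

theorem commute_of_pow_left {a b : FreeGroup α} {k : ℕ} (hk : k ≠ 0) (h : Commute (a ^ k) b) :
    Commute a b := by
  by_cases ha : a = 1
  · simp [ha]
  · exact commute_trans (by simpa [hk] using ha) (Commute.self_pow a k) h

theorem commute_pow_left_iff {a b : FreeGroup α} {k : ℕ} (hk : k ≠ 0) :
    Commute (a ^ k) b ↔ Commute a b := ⟨commute_of_pow_left hk, fun h => h.pow_left k⟩

theorem IsLine.eq_of_wdist_le {l l' : ℤ → FreeGroup α} (hl : IsLine l) (hl' : IsLine l')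
    (h0 : l 0 = l' 0) {A B r : ℤ} (hA : r ≤ A) (hB : r ≤ B)
    (h : wdist (l (-A)) (l' B) ≤ A + B - 2 * r) {i : ℤ} (hi : 0 ≤ i) (hir : i ≤ r) :
    l (-i) = l' i := by
  have e1 := hl (-i) 0
  have e2 := hl (-i) (-A)
  have e3 := hl 0 (-A)
  have e4 := hl' 0 B
  have f := wdist_four_point (l (-i)) (l' B) (l 0) (l (-A))
  have t := wdist_triangle (l 0) (l (-i)) (l' B)
  have c1 := wdist_comm (l (-i)) (l 0)
  have c2 := wdist_comm (l' B) (l 0)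
  have c3 := wdist_comm (l' B) (l (-A))
  rw [← h0] at e4
  have := hl'.eq_of_between (x := l (-i)) (s := 0) (t := B) (by rw [← h0]; omega)
  rw [← h0, ← c1, e1] at this
  rw [this]; congr 1; omega

theorem lt_wdist_of_not_commute {a b : FreeGroup α} {L L' : ℤ} {l l' : ℤ → FreeGroup α}
    (ha : IsAxis a L l) (hb : IsAxis b L' l') (h0 : l 0 = l' 0) (h : ¬ Commute a b) {A B : ℤ}
    (hA : L + L' ≤ A) (hB : L + L' ≤ B) : A + B - 2 * (L + L') < wdist (l (-A)) (l' B) := by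
  by_contra! hle
  have key := fun {i : ℤ} => ha.line.eq_of_wdist_le hb.line h0 hA hB hle (i := i)
  have h1 := ha.pos
  have h2 := hb.pos
  apply h
  rw [← Commute.inv_left_iff]
  refine commute_of_translations (l := l') (t := 0) (c := L) (d := L') ?_ (hb.map _) ?_ (hb.map _)
  all_goals
    rw [← key (by omega) (by omega), ← key (by omega) (by omega), ha.inv_mul]; congr 1; ring

theorem exists_closest {a b : FreeGroup α} {L L' : ℤ} {l l' : ℤ → FreeGroup α}
    (ha : IsAxis a L l) (hb : IsAxis b L' l') :
    ∃ l l' : ℤ → FreeGroup α, IsAxis a L l ∧ IsAxis b L' l' ∧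
      (∀ s, wdist (l' 0) (l s) = wdist (l 0) (l' 0) + s.natAbs) ∧
      (∀ s, wdist (l 0) (l' s) = wdist (l 0) (l' 0) + s.natAbs) := by
  obtain ⟨⟨s, t⟩, -, hst⟩ := WellFounded.has_min
    (InvImage.wf (fun x : ℤ × ℤ => (wdist (l x.1) (l' x.2)).toNat) Nat.lt_wfRel.wf)
    Set.univ ⟨(0, 0), trivial⟩
  have hst' : ∀ i j, wdist (l s) (l' t) ≤ wdist (l i) (l' j) := by
    intro i j
    have := hst (i, j) trivial
    change ¬ ((wdist (l i) (l' j)).toNat < (wdist (l s) (l' t)).toNat) at this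
    have h1 := wdist_nonneg (l i) (l' j)
    have h2 := wdist_nonneg (l s) (l' t)
    omega
  refine ⟨_, _, ha.shift s, hb.shift t, fun i => ?_, fun i => ?_⟩
  · obtain ⟨p, hp⟩ := ha.line.exists_proj (l' t)
    have h1 := hp s
    have h2 := hst' p t
    have h3 := hp (i + s)
    rw [wdist_comm] at h2
    rw [wdist_comm (l p)] at h2
    simp only [zero_add]
    rw [wdist_comm (l s)] at *
    omega
  · obtain ⟨p, hp⟩ := hb.line.exists_proj (l s)
    have h1 := hp t
    have h2 := hst' s p
    have h3 := hp (i + t)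
    simp only [zero_add]
    omega

/-- The word `a ^ 40 * b ^ 40` dominates `a` and `b` at a common point. -/
theorem exists_wdist_le_tlen_pow_mul_pow {a b : FreeGroup α} (h : ¬ Commute a b) :
    a ^ 40 * b ^ 40 ≠ 1 ∧ ∃ o, wdist o (a * o) ≤ tlen (a ^ 40 * b ^ 40) ∧
      wdist o (b * o) ≤ tlen (a ^ 40 * b ^ 40) := by
  have ha : a ≠ 1 := fun e => h (by simp [e])
  have hb : b ≠ 1 := fun e => h (by simp [e])
  suffices hs : ∃ o, wdist o (a * o) ≤ tlen (a ^ 40 * b ^ 40) ∧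
      wdist o (b * o) ≤ tlen (a ^ 40 * b ^ 40) by
    refine ⟨fun e => ?_, hs⟩
    obtain ⟨o, ho, -⟩ := hs
    rw [e, tlen_one] at ho
    have : 0 < wdist o (a * o) := wdist_pos (by simpa using ha)
    omega
  obtain ⟨l, l', ax, bx, hl, hl'⟩ :=
    exists_closest (exists_isAxis ha).choose_spec (exists_isAxis hb).choose_spec
  have La := ax.pos
  have Lb := bx.pos
  generalize tlen a = A at *
  generalize tlen b = B at *
  have da : wdist (l 0) (a * l 0) = A := by rw [ax.map, ax.line]; omega
  refine ⟨l 0, ?_⟩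
  have hA : wdist (l 0) (a ^ 40 * l 0) = 40 * A := by
    rw [ax.pow_mul, ax.line]; omega
  by_cases hδ : l 0 = l' 0
  · have db : wdist (l 0) (b * l 0) = B := by rw [hδ, bx.map, bx.line]; omega
    have hB : wdist (l 0) (b ^ 40 * l 0) = 40 * B := by
      rw [hδ, bx.pow_mul, bx.line]; omega
    rw [da, db]
    rcases lt_or_ge (4 * A) B with h1 | h1
    · have c : IsConfig 10 1 b (fun _ => a ^ 40) (fun _ => 40) B l' :=
        ⟨bx, fun _ => by rw [← hδ, hA]; push_cast; omega,
          fun _ => by rwa [commute_pow_left_iff (by norm_num)], fun _ => rfl, fun _ => rfl,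
          by norm_num, fun _ => by norm_num⟩
      have h2 := c.tlen_lt
      have e : chainProd b (fun _ => a ^ 40) (fun _ => 40) 1 =
        (a ^ 40)⁻¹ * (a ^ 40 * b ^ 40) * (a ^ 40)⁻¹⁻¹ := by simp [chainProd]
      rw [e, tlen_conj] at h2
      push_cast at h2
      omega
    rcases lt_or_ge (4 * B) A with h2 | h2
    · have c : IsConfig 10 1 a (fun _ => b ^ 40) (fun _ => 40) A l :=
        ⟨ax, fun _ => by rw [hB]; push_cast; omega,
          fun _ => by rw [commute_pow_left_iff (by norm_num)]; exact fun e => h e.symm,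
          fun _ => rfl, fun _ => rfl, by norm_num, fun _ => by norm_num⟩
      have h2 := c.tlen_lt
      have e : chainProd a (fun _ => b ^ 40) (fun _ => 40) 1 = a ^ 40 * b ^ 40 := by
        simp [chainProd]
      rw [e] at h2
      push_cast at h2
      omega
    · have o1 := lt_wdist_of_not_commute ax bx hδ h (A := 40 * A) (B := 40 * B) (by omega)
        (by omega)
      have o2 := lt_wdist_of_not_commute bx ax hδ.symm (fun e => h e.symm) (A := 40 * B)
        (B := 40 * A) (by omega) (by omega)
      rw [← wdist_mul_left (a ^ 40), ax.pow_mul,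
        show -(40 * A) + (40 : ℕ) * A = 0 by push_cast; ring,
        show l' (40 * B) = b ^ 40 * l' 0 by rw [bx.pow_mul]; simp, ← hδ] at o1
      rw [← wdist_mul_left (b ^ 40), bx.pow_mul,
        show -(40 * B) + (40 : ℕ) * B = 0 by push_cast; ring, ← hδ,
        show l (40 * A) = a ^ 40 * l 0 by rw [ax.pow_mul]; simp] at o2
      have := le_tlen_mul (a := a ^ 40) (b := b ^ 40) (o := l 0) (by omega) (by omega)
      omega
  · have hpos := wdist_pos hδ
    have db : wdist (l 0) (b * l 0) ≤ 2 * wdist (l 0) (l' 0) + B := by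
      have t1 := wdist_triangle (l 0) (l' 0) (b * l 0)
      have t2 := wdist_triangle (l' 0) (b * l' 0) (b * l 0)
      have := wdist_comm (l' 0) (l 0)
      rw [wdist_mul_left, bx.map, bx.line] at t2
      omega
    have hB : wdist (l 0) (b ^ 40 * l 0) = 40 * B + 2 * wdist (l 0) (l' 0) := by
      have := (bx.pow (k := 40) (by norm_num)).wdist_mul (x := l 0) (s := 0)
        (fun t => by rw [hl']; congr 2; omega)
      rw [this]; push_cast; ring
    have path : ∀ A' B' : ℤ, 0 < A' → 0 < B' → ∀ r : ℤ, r = 1 ∨ r = -1 →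
        ∀ w, wdist (l' 0) w = B' + wdist (l 0) (l' 0) →
          wdist (l' (r * B')) w = wdist (l 0) (l' 0) →
          wdist (l (-(r * A'))) w = A' + B' + 2 * wdist (l 0) (l' 0) := by
      intro A' B' hA' hB' r hr w hw1 hw2
      have e1 := hl (-(r * A'))
      have e2 := hl' (r * B')
      have e3 := ax.line (-(r * A')) 0
      have e4 := bx.line 0 (r * B')
      have c1 := wdist_comm (l' 0) (l (-(r * A')))
      have n1 : (r * A').natAbs = A' := by rcases hr with rfl | rfl <;> omega
      have n2 : (r * B').natAbs = B' := by rcases hr with rfl | rfl <;> omega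
      have s1 := wdist_add_of_overlap (x := l (-(r * A'))) (y := l 0) (z := l' 0) (w := l' (r * B'))
        (by omega) (by omega) hδ
      have s2 := wdist_add_of_overlap (x := l (-(r * A'))) (y := l' 0) (z := l' (r * B')) (w := w)
        (by omega) (by omega) (fun e => by have := bx.line.inj e; omega)
      omega
    have t1 : ∀ t, wdist (l' t) (b ^ 40 * l 0) = wdist (l 0) (l' (t - 40 * B)) := fun t => by
      have : b ^ 40 * l' (t - 40 * B) = l' t := by rw [bx.pow_mul]; congr 1; omega
      rw [wdist_comm (l 0), ← this, wdist_mul_left]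
    have t2 : ∀ t, wdist (l' t) ((b ^ 40)⁻¹ * l 0) = wdist (l 0) (l' (t + 40 * B)) := fun t => by
      have : (b ^ 40)⁻¹ * l' (t + 40 * B) = l' t := by rw [inv_mul_eq_iff_eq_mul, bx.pow_mul]; rfl
      rw [wdist_comm (l 0), ← this, wdist_mul_left]
    have o1 := path (40 * A) (40 * B) (by omega) (by omega) 1 (Or.inl rfl) (b ^ 40 * l 0)
      (by rw [t1, hl']; omega) (by rw [t1, hl']; omega)
    have o2 := path (40 * A) (40 * B) (by omega) (by omega) (-1) (Or.inr rfl) ((b ^ 40)⁻¹ * l 0)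
      (by rw [t2, hl']; omega) (by rw [t2, hl']; omega)
    rw [← wdist_mul_left (a ^ 40), ax.pow_mul,
      show -(1 * (40 * A)) + (40 : ℕ) * A = 0 by push_cast; ring] at o1
    rw [← wdist_mul_left (b ^ 40), mul_inv_cancel_left, wdist_comm,
      show -(-1 * (40 * A)) = 0 + (40 : ℕ) * A by push_cast; ring, ← ax.pow_mul] at o2
    have := le_tlen_mul (a := a ^ 40) (b := b ^ 40) (o := l 0) (by omega) (by omega)
    omega

end FreeGroup

/-- The exponents used in `tagWord`. -/
def tagExp (N k p i : ℕ) : ℕ :=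
  if i % 6 = 0 then 6 * (2 * N + 246) + 338 else
    if i % 6 = 2 then N + k else if i % 6 = 4 then N + p else N

/-- The word `u ^ T * a * u ^ N * a * u ^ (N + k) * a * u ^ N * a⁻¹ * u ^ (N + p) * a⁻¹ *
u ^ N * a⁻¹`. -/
def tagChain {G : Type*} [Group G] (N k p : ℕ) (u a : G) : G :=
  chainProd u (fun i => if i % 6 < 3 then a else a⁻¹) (tagExp N k p) 6

/-- A word in `a` and `b` from which the tag `k` can be recovered if `a` and `b` do not commute. -/
def tagWord {G : Type*} [Group G] (N k : ℕ) (a b : G) : G :=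
  tagChain N k 1 (a ^ 40 * b ^ 40) a

section Group

variable {G H : Type*} [Group G] [Group H] (N k : ℕ)

theorem map_tagChain (f : G →* H) (k' : ℕ) (u a : G) :
    f (tagChain N k k' u a) = tagChain N k k' (f u) (f a) := by
  rw [tagChain, map_chainProd, tagChain]
  congr 1
  ext i
  split_ifs <;> simp

theorem map_tagWord (f : G →* H) (a b : G) : f (tagWord N k a b) = tagWord N k (f a) (f b) := by
  rw [tagWord, map_tagChain, tagWord]; simp

theorem tagChain_inv (k' : ℕ) (u a : G) : (u ^ tagExp N k k' 0)⁻¹ * (tagChain N k k' u a)⁻¹ *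
    (u ^ tagExp N k k' 0) = tagChain N k' k u⁻¹ a := by
  simp only [tagChain, chainProd, tagExp]
  norm_num
  group

theorem tagWord_one_right (a : G) : ∃ p : ℕ, p ≠ 0 ∧ tagWord N k a 1 = a ^ p := by
  refine ⟨40 * (6 * (2 * N + 246) + 338 + N + (N + k) + N + (N + 1) + N), by positivity, ?_⟩
  simp only [tagWord, tagChain, chainProd, tagExp]
  norm_num
  simp only [← pow_mul, ← pow_add, ← pow_succ]
  simp only [← zpow_natCast, ← zpow_neg_one, ← zpow_add]
  congr 1; push_cast; ring

theorem tagWord_one_left (b : G) : ∃ p : ℕ, p ≠ 0 ∧ tagWord N k 1 b = b ^ p := by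
  refine ⟨40 * (6 * (2 * N + 246) + 338 + N + (N + k) + N + (N + 1) + N), by positivity, ?_⟩
  simp only [tagWord, tagChain, chainProd, tagExp]
  norm_num
  simp only [← pow_mul, ← pow_add]
  congr 1; ring

theorem tagWord_inv_right (a : G) : tagWord N k a a⁻¹ = 1 := by
  simp only [tagWord, tagChain, chainProd, tagExp]
  simp

end Group

namespace FreeGroup

variable {α : Type*} [DecidableEq α]

theorem tlen_le_tlen_zpow (g : FreeGroup α) {k : ℤ} (hk : k ≠ 0) : tlen g ≤ tlen (g ^ k) := by
  by_cases hg : g = 1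
  · simp [hg]
  obtain ⟨l, a⟩ := exists_isAxis hg
  have hL := a.pos
  rcases lt_or_gt_of_ne hk with h | h
  · obtain ⟨n, rfl⟩ : ∃ n : ℕ, k = -n := ⟨k.natAbs, by omega⟩
    have := (a.rev.pow (k := n) (by omega)).tlen_eq
    rw [zpow_neg, zpow_natCast, ← inv_pow, this]
    have : (1 : ℤ) ≤ n := by omega
    nlinarith
  · obtain ⟨n, rfl⟩ : ∃ n : ℕ, k = n := ⟨k.natAbs, by omega⟩
    rw [zpow_natCast, (a.pow (k := n) (by omega)).tlen_eq]
    have : (1 : ℤ) ≤ n := by omega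
    nlinarith

theorem exists_isAxis_wdist_le {u : FreeGroup α} (hu : u ≠ 1) (o : FreeGroup α) :
    ∃ l, IsAxis u (tlen u) l ∧
      ∀ g, wdist (l 0) (g * l 0) ≤ wdist o (u * o) - tlen u + wdist o (g * o) := by
  obtain ⟨l, a⟩ := exists_isAxis hu
  obtain ⟨s, hs⟩ := a.line.exists_proj o
  refine ⟨_, a.shift s, fun g => ?_⟩
  have h := a.wdist_mul hs
  have t1 := wdist_triangle (l s) o (g * l s)
  have t2 := wdist_triangle o (g * o) (g * l s)
  have c := wdist_comm (l s) o
  rw [wdist_mul_left] at t2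
  simp only [zero_add]
  omega

theorem isBigConfig_tag {u a : FreeGroup α} {N k k' : ℕ} {L : ℤ} {l : ℤ → FreeGroup α}
    (ax : IsAxis u L l) (hd : wdist (l 0) (a * l 0) ≤ 80 * L) (hc : ¬ Commute a u) (hN : 910 ≤ N)
    (hk : k ≤ N) (hk' : k' ≤ N) :
    IsBigConfig 80 N (6 * (2 * N + 246) + 338) 6 u (fun i => if i % 6 < 3 then a else a⁻¹)
      (tagExp N k k') L l where
  axis := ax
  disp i := by
    split_ifs
    · exact_mod_cast hd
    · rw [← wdist_mul_left a, mul_inv_cancel_left, wdist_comm]; exact_mod_cast hd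
  ncomm i := by
    split_ifs
    · exact hc
    · rwa [Commute.inv_left_iff]
  perP i := by simp
  perM i := by simp [tagExp]
  m_pos := by norm_num
  le_M i := by unfold tagExp; split_ifs <;> omega
  M_zero := by simp [tagExp]
  M_mem i h0 h6 := by unfold tagExp; split_ifs <;> omega
  le_N := by omega
  le_T := by omega

/-- Decoding at three consecutive equal letters. -/
theorem eq_of_decode {u v : FreeGroup α} {M M' : ℕ → ℕ} {P Q z : ℕ → FreeGroup α} (hu : u ≠ 1)
    (huv : Commute u v) (hz : ∀ i, Commute (z i) u) (hP : ∀ i, ¬ Commute (P i) u)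
    (h : ∀ i, Q i = (v ^ M' i)⁻¹ * (z i)⁻¹ * u ^ M i * P i * z (i + 1)) {i j : ℕ}
    (hij : P i = P j) (hij' : Q i = Q j) :
    (v ^ M' i)⁻¹ * (z i)⁻¹ * u ^ M i = (v ^ M' j)⁻¹ * (z j)⁻¹ * u ^ M j ∧
      z (i + 1) = z (j + 1) := by
  have hc : ∀ i, Commute ((v ^ M' i)⁻¹ * (z i)⁻¹ * u ^ M i) u := fun i =>
    (((huv.symm.pow_left _).inv_left).mul_left (hz i).inv_left).mul_left (Commute.pow_self u _)
  refine eq_of_mul_mul_eq hu (hP i) (hc i) (hc j) (hz _) (hz _) ?_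
  rw [← h, hij, ← h, hij']

omit [DecidableEq α] in
theorem zpow_eq_of_decode {u v z : FreeGroup α} {p q p' q' : ℕ} (hz : Commute z u)
    (h : (v ^ p')⁻¹ * z⁻¹ * u ^ p = (v ^ q')⁻¹ * z⁻¹ * u ^ q) :
    u ^ (q - p : ℤ) = v ^ (q' - p' : ℤ) := by
  have h1 : v ^ (q' - p' : ℤ) * z⁻¹ = z⁻¹ * u ^ (q - p : ℤ) := by
    calc _ = v ^ q' * ((v ^ p')⁻¹ * z⁻¹ * u ^ p) * (u ^ p)⁻¹ := by
          rw [zpow_sub, zpow_natCast, zpow_natCast]; group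
      _ = _ := by rw [h, zpow_sub, zpow_natCast, zpow_natCast]; group
  rw [((hz.inv_left).zpow_right _).eq] at h1
  exact (mul_right_cancel h1).symm

theorem tagChain_eq {u a u' a' : FreeGroup α} {N k₁ k₂ k₁' k₂' : ℕ} {L L' : ℤ}
    {l l' : ℤ → FreeGroup α}
    (ax : IsAxis u L l) (hd : wdist (l 0) (a * l 0) ≤ 80 * L) (hc : ¬ Commute a u)
    (ax' : IsAxis u' L' l') (hd' : wdist (l' 0) (a' * l' 0) ≤ 80 * L') (hc' : ¬ Commute a' u')
    (hN : 910 ≤ N) (h₁ : k₁ ≤ N) (h₂ : k₂ ≤ N) (h₁' : k₁' ≤ N) (h₂' : k₂' ≤ N)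
    (h : tagChain N k₁ k₂ u a = tagChain N k₁' k₂' u' a') :
    ∃ v, u ^ k₁ = v ^ k₁' ∧ u ^ k₂ = v ^ k₂' := by
  have c := isBigConfig_tag ax hd hc hN h₁ h₂
  obtain ⟨e, s, z, -, -, z6, huv, hz, key⟩ :=
    c.decode (isBigConfig_tag ax' hd' hc' hN h₁' h₂') h
  have key' := fun i j => eq_of_decode (i := i) (j := j) ax.ne_one huv hz c.ncomm key
  refine ⟨s * u' * s⁻¹, ?_, ?_⟩
  · obtain ⟨e1, e2⟩ := key' 1 2 (by norm_num) (by norm_num)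
    rw [← (key' 0 1 (by norm_num) (by norm_num)).2] at e1
    have := zpow_eq_of_decode (hz _) e1
    simpa [tagExp] using this
  · obtain ⟨e1, e2⟩ := key' 4 5 (by norm_num) (by norm_num)
    rw [← (key' 3 4 (by norm_num) (by norm_num)).2] at e1
    have := zpow_eq_of_decode (hz _) e1.symm
    simpa [tagExp] using this

theorem not_commute_pow_mul_pow {a b : FreeGroup α} {i j : ℕ} (hj : j ≠ 0)
    (h : ¬ Commute a b) : ¬ Commute a (a ^ i * b ^ j) := by
  intro hc
  have h1 := ((Commute.self_pow a i).inv_right).mul_right hc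
  rw [inv_mul_cancel_left] at h1
  exact h (commute_of_pow_left hj h1.symm).symm

section Tag

variable {N k : ℕ} {a b : FreeGroup α}

theorem exists_isAxis_tag (h : ¬ Commute a b) :
    ∃ l, IsAxis (a ^ 40 * b ^ 40) (tlen (a ^ 40 * b ^ 40)) l ∧
      wdist (l 0) (a * l 0) ≤ 80 * tlen (a ^ 40 * b ^ 40) := by
  obtain ⟨h1, o, ha, hb⟩ := exists_wdist_le_tlen_pow_mul_pow h
  obtain ⟨l, ax, hl⟩ := exists_isAxis_wdist_le h1 o
  refine ⟨l, ax, ?_⟩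
  have e := hl a
  have hp : ∀ (g : FreeGroup α) (n : ℕ), wdist o (g ^ n * o) ≤ n * wdist o (g * o) := by
    intro g n
    induction n with
    | zero => simp
    | succ n ih =>
      have := wdist_triangle o (g * o) (g ^ (n + 1) * o)
      rw [pow_succ', mul_assoc, wdist_mul_left] at this
      rw [pow_succ', mul_assoc]
      push_cast
      linarith
  have t := wdist_triangle o (a ^ 40 * o) (a ^ 40 * b ^ 40 * o)
  rw [mul_assoc, wdist_mul_left] at t
  rw [mul_assoc] at e
  have h2 := hp a 40
  have h3 := hp b 40
  push_cast at h2 h3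
  linarith

theorem exists_isBigConfig_tag (h : ¬ Commute a b) (hN : 910 ≤ N) (hk : k ≤ N) :
    ∃ l, IsBigConfig 80 N (6 * (2 * N + 246) + 338) 6 (a ^ 40 * b ^ 40)
      (fun i => if i % 6 < 3 then a else a⁻¹) (tagExp N k 1) (tlen (a ^ 40 * b ^ 40)) l := by
  obtain ⟨l, ax, hd⟩ := exists_isAxis_tag h
  exact ⟨l, isBigConfig_tag ax hd (not_commute_pow_mul_pow (by norm_num) h) hN hk
    (by omega)⟩

theorem tlen_base_le_tlen_tagWord (h : ¬ Commute a b) (hN : 910 ≤ N) (hk : k ≤ N) :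
    tlen (a ^ 40 * b ^ 40) ≤ tlen (tagWord N k a b) := by
  obtain ⟨l, c⟩ := exists_isBigConfig_tag h hN hk
  have h1 := c.bounds.1
  have h2 := c.axis.pos
  rw [tagWord, tagChain]
  push_cast at h1
  nlinarith

theorem tagWord_ne_one (h : ¬ Commute a b) (hN : 910 ≤ N) (hk : k ≤ N) : tagWord N k a b ≠ 1 := by
  obtain ⟨l, c⟩ := exists_isBigConfig_tag h hN hk
  exact c.ne_one

theorem not_commute_tagWord {c d : FreeGroup α} {k' : ℕ} (h : ¬ Commute a b) (h' : ¬ Commute c d)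
    (hN : 910 ≤ N) (hk : k ≤ N) (hk' : k' ≤ N) (h2 : 2 ≤ k) (hne : k ≠ k') :
    ¬ Commute (tagWord N k a b) (tagWord N k' c d) := by
  intro hc
  obtain ⟨l, ax, hd⟩ := exists_isAxis_tag h
  obtain ⟨l', ax', hd'⟩ := exists_isAxis_tag h'
  have hu := not_commute_pow_mul_pow (i := 40) (j := 40) (by norm_num) h
  have hu' := not_commute_pow_mul_pow (i := 40) (j := 40) (by norm_num) h'
  obtain ⟨p, hp⟩ := (isBigConfig_tag ax hd hu hN hk (by omega : 1 ≤ N)).exists_zpow_of_commute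
    hc.symm
  obtain ⟨q, hq⟩ := (isBigConfig_tag ax' hd' hu' hN hk' (by omega : 1 ≤ N)).exists_zpow_of_commute
    hc
  change tagWord N k' c d = tagWord N k a b ^ p at hp
  change tagWord N k a b = tagWord N k' c d ^ q at hq
  have h1 := tagWord_ne_one h hN hk
  have hpq : p * q = 1 := by
    rw [hp, ← zpow_mul] at hq
    by_contra hne
    have : tagWord N k a b ^ (p * q - 1) = 1 := by rw [zpow_sub_one, ← hq, mul_inv_cancel]
    exact h1 ((IsMulTorsionFree.zpow_eq_one_iff_left (by omega)).1 this)
  rcases Int.eq_one_or_neg_one_of_mul_eq_one hpq with rfl | rfl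
  · rw [zpow_one] at hp
    obtain ⟨v, e1, e2⟩ := tagChain_eq ax hd hu ax' hd' hu' hN hk (by omega) hk' (by omega) hp.symm
    rw [pow_one, pow_one] at e2
    rw [← e2] at e1
    exact hne ((IsMulTorsionFree.pow_right_injective ax.ne_one) e1)
  · have e0 := tagChain_inv N k' 1 (c ^ 40 * d ^ 40) c
    generalize (c ^ 40 * d ^ 40) ^ tagExp N k' 1 0 = s at e0
    have e3 : tagChain N k 1 (s⁻¹ * (a ^ 40 * b ^ 40) * s⁻¹⁻¹) (s⁻¹ * a * s⁻¹⁻¹) =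
        tagChain N 1 k' (c ^ 40 * d ^ 40)⁻¹ c := by
      rw [← e0]
      have := map_tagChain N k (MulAut.conj s⁻¹).toMonoidHom 1 (a ^ 40 * b ^ 40) a
      simp only [MulEquiv.coe_toMonoidHom, MulAut.conj_apply] at this
      rw [← this, ← tagWord, ← tagWord, hp]
      simp
    obtain ⟨v, e1, e2⟩ := tagChain_eq (ax.conj s⁻¹)
      (by
        rw [show s⁻¹ * a * s⁻¹⁻¹ * (s⁻¹ * l 0) = s⁻¹ * (a * l 0) by group, wdist_mul_left]
        exact hd)
      ((Commute.conj_iff _).not.2 hu) ax'.rev hd' (Commute.inv_right_iff.not.2 hu') hN hk (by omega)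
      (by omega) hk' e3
    rw [pow_one] at e1 e2
    rw [← e1, ← pow_mul] at e2
    have := (IsMulTorsionFree.pow_right_injective (ax.conj s⁻¹).ne_one) ((pow_one _).trans e2)
    have := Nat.eq_one_of_mul_eq_one_right this.symm
    omega

end Tag

/-- A nontrivial element commuting with a word whose tag lies in `[lo, hi)`. -/
def Tagged (N lo hi : ℕ) (g : FreeGroup α) : Prop :=
  g ≠ 1 ∧ ∃ k, lo ≤ k ∧ k < hi ∧ ∃ a b : FreeGroup α, ¬ Commute a b ∧ Commute g (tagWord N k a b)

omit [DecidableEq α] in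
theorem Tagged.mono {N lo hi lo' hi' : ℕ} {g : FreeGroup α} (h : Tagged N lo hi g)
    (hl : lo' ≤ lo) (hh : hi ≤ hi') : Tagged N lo' hi' g := by
  obtain ⟨h1, k, h2, h3, h4⟩ := h
  exact ⟨h1, k, by omega, by omega, h4⟩

omit [DecidableEq α] in
theorem Tagged.pow {N lo hi p : ℕ} {g : FreeGroup α} (h : Tagged N lo hi g) (hp : p ≠ 0) :
    Tagged N lo hi (g ^ p) := by
  obtain ⟨h1, k, h2, h3, a, b, h4, h5⟩ := h
  exact ⟨by simpa [hp] using h1, k, h2, h3, a, b, h4, h5.pow_left p⟩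

theorem Tagged.not_commute {N lo hi lo' hi' : ℕ} {g g' : FreeGroup α} (h : Tagged N lo hi g)
    (h' : Tagged N lo' hi' g') (hlo : 2 ≤ lo) (hd : hi ≤ lo') (hN : 910 ≤ N) (hi' : hi' ≤ N) :
    ¬ Commute g g' := by
  obtain ⟨h1, k, h2, h3, a, b, h4, h5⟩ := h
  obtain ⟨h1', k', h2', h3', a', b', h4', h5'⟩ := h'
  intro hc
  refine not_commute_tagWord h4 h4' hN (k := k) (k' := k') (by omega) (by omega) (by omega)
    (by omega) (commute_trans h1 h5.symm (commute_trans h1' hc h5'))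

theorem Tagged.tagWord {N lo k : ℕ} {a b : FreeGroup α} (ha : a = 1 ∨ Tagged N lo k a)
    (hb : b = 1 ∨ Tagged N (k + 1) (k + 2) b) (hlo : 2 ≤ lo) (hlk : lo ≤ k) (hN : 910 ≤ N)
    (hk : k + 2 ≤ N) :
    (tagWord N k a b = 1 ∨ Tagged N lo (k + 2) (tagWord N k a b)) ∧
      tlen a ≤ tlen (tagWord N k a b) ∧ tlen b ≤ tlen (tagWord N k a b) := by
  rcases hb with rfl | hb
  · obtain ⟨p, hp, e⟩ := tagWord_one_right N k a
    rw [e]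
    refine ⟨ha.imp (fun h => by simp [h]) fun h => (h.mono le_rfl (by omega)).pow hp, ?_, ?_⟩
    · exact_mod_cast tlen_le_tlen_zpow a (k := p) (by omega)
    · rw [tlen_one]; exact tlen_nonneg _
  rcases ha with rfl | ha
  · obtain ⟨p, hp, e⟩ := tagWord_one_left N k b
    rw [e]
    refine ⟨Or.inr ((hb.mono (by omega) le_rfl).pow hp), ?_, ?_⟩
    · rw [tlen_one]; exact tlen_nonneg _
    · exact_mod_cast tlen_le_tlen_zpow b (k := p) (by omega)
  have h := ha.not_commute hb hlo (by omega) hN hk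
  have h1 := tlen_base_le_tlen_tagWord h hN (k := k) (by omega)
  obtain ⟨-, o, h2, h3⟩ := exists_wdist_le_tlen_pow_mul_pow h
  exact ⟨Or.inr ⟨tagWord_ne_one h hN (by omega), k, by omega, by omega, a, b, h, Commute.refl _⟩,
    (tlen_le a o).trans (h2.trans h1), (tlen_le b o).trans (h3.trans h1)⟩

/-- A word in `a` and `b` that is trivial if and only if `a` and `b` commute. -/
def pairWord {G : Type*} [Group G] (N k : ℕ) (a b : G) : G :=
  _root_.tagWord N k (a ^ 40 * b ^ 40) (a * (a ^ 40 * b ^ 40)⁻¹ * a⁻¹)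

theorem map_pairWord {G H : Type*} [Group G] [Group H] (f : G →* H) (N k : ℕ) (a b : G) :
    f (pairWord N k a b) = pairWord N k (f a) (f b) := by
  rw [pairWord, map_tagWord, pairWord]; simp

theorem pairWord_eq_one {G : Type*} [Group G] (N k : ℕ) {a b : G} (h : Commute a b) :
    pairWord N k a b = 1 := by
  have : Commute a (a ^ 40 * b ^ 40)⁻¹ :=
    (((Commute.refl a).pow_right _).mul_right (h.pow_right _)).inv_right
  rw [pairWord, this.eq, mul_inv_cancel_right, tagWord_inv_right]

theorem tagged_pairWord {N k : ℕ} {a b : FreeGroup α} (h : ¬ Commute a b) (hN : 910 ≤ N)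
    (hk : k ≤ N) : Tagged N k (k + 1) (pairWord N k a b) ∧
      ∃ o, wdist o (a * o) ≤ tlen (pairWord N k a b) ∧
        wdist o (b * o) ≤ tlen (pairWord N k a b) := by
  obtain ⟨h1, o, h2, h3⟩ := exists_wdist_le_tlen_pow_mul_pow h
  have hc : ¬ Commute (a ^ 40 * b ^ 40) (a * (a ^ 40 * b ^ 40)⁻¹ * a⁻¹) := fun hc => by
    rw [← conj_inv, Commute.inv_right_iff] at hc
    exact not_commute_pow_mul_pow (by norm_num) h (commute_of_commute_conj h1 hc)
  have h4 := tlen_base_le_tlen_tagWord hc hN hk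
  obtain ⟨-, o', h5, -⟩ := exists_wdist_le_tlen_pow_mul_pow hc
  have h6 := (tlen_le _ o').trans (h5.trans h4)
  exact ⟨⟨tagWord_ne_one hc hN hk, k, le_rfl, by omega, _, _, hc, Commute.refl _⟩, o,
    h2.trans h6, h3.trans h6⟩

/-- A word combining the words `pairWord` of all pairs in a list. -/
def listWord {G : Type*} [Group G] (N k : ℕ) : List (G × G) → G
  | [] => 1
  | e :: l => _root_.tagWord N (k + 2 * l.length) (listWord N k l)
      (pairWord N (k + 2 * l.length + 1) e.1 e.2)

theorem map_listWord {G H : Type*} [Group G] [Group H] (f : G →* H) (N k : ℕ) (l : List (G × G)) :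
    f (listWord N k l) = listWord N k (l.map (Prod.map f f)) := by
  induction l with
  | nil => simp [listWord]
  | cons e l ih => simp [listWord, map_tagWord, map_pairWord, ih]

theorem listWord_eq_one {G : Type*} [Group G] (N k : ℕ) {l : List (G × G)}
    (h : ∀ e ∈ l, Commute e.1 e.2) : listWord N k l = 1 := by
  induction l with
  | nil => rfl
  | cons e l ih =>
    rw [listWord, ih fun e he => h e (by simp [he]), pairWord_eq_one _ _ (h e (by simp))]
    obtain ⟨p, -, hp⟩ := tagWord_one_left N (k + 2 * l.length) (1 : G)
    rw [hp, one_pow]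

theorem tagged_listWord {N k : ℕ} (hk : 2 ≤ k) (hN : 910 ≤ N) {l : List (FreeGroup α × FreeGroup α)}
    (hl : k + 2 * l.length ≤ N) :
    (listWord N k l = 1 ∨ Tagged N k (k + 2 * l.length) (listWord N k l)) ∧
      ∀ e ∈ l, ¬ Commute e.1 e.2 → ∃ o, wdist o (e.1 * o) ≤ tlen (listWord N k l) ∧
        wdist o (e.2 * o) ≤ tlen (listWord N k l) := by
  induction l with
  | nil => simp [listWord]
  | cons e l ih =>
    simp only [List.length_cons] at hl ⊢
    obtain ⟨ih1, ih2⟩ := ih (by omega)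
    have hp : pairWord N (k + 2 * l.length + 1) e.1 e.2 = 1 ∨
        Tagged N (k + 2 * l.length + 1) (k + 2 * l.length + 2)
          (pairWord N (k + 2 * l.length + 1) e.1 e.2) := by
      by_cases h : Commute e.1 e.2
      · exact Or.inl (pairWord_eq_one _ _ h)
      · exact Or.inr (tagged_pairWord h hN (by omega)).1
    obtain ⟨h1, h2, h3⟩ := Tagged.tagWord ih1 hp hk (by omega) hN (by omega)
    refine ⟨h1, fun e' he' hc => ?_⟩
    rcases List.mem_cons.1 he' with rfl | he'
    · obtain ⟨o, h4, h5⟩ := (tagged_pairWord hc hN (k := k + 2 * l.length + 1) (by omega)).2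
      exact ⟨o, h4.trans h3, h5.trans h3⟩
    · obtain ⟨o, h4, h5⟩ := ih2 e' he' hc
      exact ⟨o, h4.trans h2, h5.trans h2⟩

section Helly

theorem exists_median (x y z : FreeGroup α) : ∃ m, wdist x m + wdist m y = wdist x y ∧
    wdist x m + wdist m z = wdist x z ∧ wdist y m + wdist m z = wdist y z := by
  have t1 := wdist_triangle x y z
  have t2 := wdist_triangle y x z
  have t3 := wdist_triangle x z y
  have c1 := wdist_comm x y
  have c2 := wdist_comm z y
  have p := wdist_parity x y z
  obtain ⟨m, h1, h2⟩ := exists_between x y (k := (wdist x y + wdist x z - wdist y z) / 2)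
    (by omega) (by omega)
  have f := wdist_four_point m z x y
  have t4 := wdist_triangle x m z
  have t5 := wdist_triangle y m z
  have c3 := wdist_comm x m
  have c4 := wdist_comm y m
  have c5 := wdist_comm z x
  exact ⟨m, by omega, by omega, by omega⟩

/-- Convexity of a set of vertices in the Cayley tree. -/
def IsGeodesicallyConvex (B : Set (FreeGroup α)) : Prop :=
  ∀ x ∈ B, ∀ y ∈ B, ∀ z, wdist x z + wdist z y = wdist x y → z ∈ B

theorem isGeodesicallyConvex_displacement (g : FreeGroup α) (D : ℤ) :
    IsGeodesicallyConvex {o | wdist o (g * o) ≤ D} := by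
  intro x hx y hy z hz
  simp only [Set.mem_ofPred_eq] at *
  have f1 := wdist_four_point x y z (g * z)
  have f2 := wdist_four_point (g * x) (g * y) x (g * z)
  have f3 := wdist_four_point (g * x) (g * y) y (g * z)
  have t1 := wdist_triangle x y (g * y)
  have t2 := wdist_triangle y x (g * x)
  have n1 := wdist_nonneg x z
  have n2 := wdist_nonneg z y
  have c1 := wdist_comm x y
  have c2 := wdist_comm (g * x) x
  have c3 := wdist_comm (g * y) y
  have c4 := wdist_comm (g * y) x
  have c5 := wdist_comm (g * x) y
  have c6 := wdist_comm z y
  have c7 := wdist_comm (g * z) (g * y)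
  simp only [wdist_mul_left] at *
  omega

theorem exists_mem_of_pairwise {ι : Type*} (s : Finset ι) (B : ι → Set (FreeGroup α))
    (hB : ∀ i ∈ s, IsGeodesicallyConvex (B i)) (h : ∀ i ∈ s, ∀ j ∈ s, (B i ∩ B j).Nonempty) :
    ∃ o, ∀ i ∈ s, o ∈ B i := by
  classical
  induction s using Finset.induction_on generalizing B with
  | empty => simp
  | insert a s ha ih =>
    rcases s.eq_empty_or_nonempty with rfl | ⟨b, hb⟩
    · obtain ⟨o, ho, -⟩ := h a (by simp) a (by simp)
      exact ⟨o, by simpa using ho⟩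
    obtain ⟨o, ho⟩ := ih (fun i => B i ∩ B a)
      (fun i hi x hx y hy z hz => ⟨hB i (by simp [hi]) x hx.1 y hy.1 z hz,
        hB a (by simp) x hx.2 y hy.2 z hz⟩)
      (fun i hi j hj => by
        obtain ⟨x, hx⟩ := h i (by simp [hi]) j (by simp [hj])
        obtain ⟨y, hy⟩ := h i (by simp [hi]) a (by simp)
        obtain ⟨z, hz⟩ := h j (by simp [hj]) a (by simp)
        obtain ⟨m, h1, h2, h3⟩ := exists_median x y z
        have m1 := hB i (by simp [hi]) x hx.1 y hy.1 m h1
        have m2 := hB j (by simp [hj]) x hx.2 z hz.1 m h2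
        have m3 := hB a (by simp) y hy.2 z hz.2 m h3
        exact ⟨m, ⟨m1, m3⟩, m2, m3⟩)
    refine ⟨o, fun i hi => ?_⟩
    rcases Finset.mem_insert.1 hi with rfl | hi
    · exact (ho b hb).2
    · exact (ho i hi).1

end Helly

theorem exists_wdist_le_of_commute {a b : FreeGroup α} (h : Commute a b) :
    ∃ o, wdist o (a * o) ≤ tlen a ∧ wdist o (b * o) ≤ tlen b := by
  by_cases ha : a = 1
  · obtain ⟨o, ho⟩ := exists_tlen b
    exact ⟨o, by simp [ha], ho.le⟩
  obtain ⟨l, ax⟩ := exists_isAxis ha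
  obtain ⟨c, hc⟩ := ax.exists_translation h.symm
  refine ⟨l 0, by rw [ax.map, ax.line]; have := ax.pos; omega, ?_⟩
  have hb : wdist (l 0) (b * l 0) = c.natAbs := by rw [hc, ax.line]; omega
  rw [hb]
  rcases lt_trichotomy c 0 with h0 | h0 | h0
  · have : IsAxis b⁻¹ (-c) l := ⟨by omega, ax.line, fun t => by
      rw [inv_mul_eq_iff_eq_mul, hc]; simp⟩
    have := this.rev.tlen_eq
    rw [inv_inv] at this
    omega
  · have := tlen_nonneg b; omega
  · have : IsAxis b c l := ⟨h0, ax.line, hc⟩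
    have := this.tlen_eq
    omega

/-- A word `domWord N k n` in `n` letters whose value is trivial on commuting tuples and moves
every point of the tree at least as much as all the letters move some fixed point. -/
noncomputable def domWord (N k n : ℕ) : FreeGroup (Fin n) :=
  listWord N k ((Finset.univ : Finset (Fin n × Fin n)).toList.map (Prod.map of of))

section DomWord

variable {N k n : ℕ}

theorem map_domWord_eq_one {G : Type*} [Group G] (f : FreeGroup (Fin n) →* G)
    (h : ∀ i j, Commute (f (of i)) (f (of j))) : f (domWord N k n) = 1 := by
  rw [domWord, map_listWord, listWord_eq_one]
  rw [List.map_map]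
  intro e he
  obtain ⟨⟨i, j⟩, -, rfl⟩ := List.mem_map.1 he
  exact h i j

variable {f : FreeGroup (Fin n) →* FreeGroup α}

theorem exists_wdist_le_tlen_domWord (hk : 2 ≤ k) (hN : 910 ≤ N) (hn : k + 2 * (n * n) ≤ N)
    (h : ¬ ∀ i j, Commute (f (of i)) (f (of j))) :
    Tagged N k (k + 2 * (n * n)) (f (domWord N k n)) ∧
      ∃ o, ∀ i, wdist o (f (of i) * o) ≤ tlen (f (domWord N k n)) := by
  set l := ((Finset.univ : Finset (Fin n × Fin n)).toList.map (Prod.map of of)).map (Prod.map f f)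
    with hl
  have hf : f (domWord N k n) = listWord N k l := by rw [domWord, map_listWord]
  have hlen : l.length = n * n := by simp [hl]
  obtain ⟨h1, h2⟩ := tagged_listWord (l := l) hk hN (by rwa [hlen])
  rw [← hf, hlen] at h1
  rw [← hf] at h2
  have h3 : ∀ i j, ¬ Commute (f (of i)) (f (of j)) → ∃ o,
      wdist o (f (of i) * o) ≤ tlen (f (domWord N k n)) ∧
      wdist o (f (of j) * o) ≤ tlen (f (domWord N k n)) := fun i j =>
    h2 (f (of i), f (of j)) (by simp [hl])
  push Not at h
  obtain ⟨i, j, hij⟩ := h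
  obtain ⟨o, hi, -⟩ := h3 i j hij
  refine ⟨h1.resolve_left fun h4 => ?_, ?_⟩
  · rw [h4, tlen_one] at hi
    have : 0 < wdist o (f (of i) * o) := wdist_pos fun e => hij (by
      rw [right_eq_mul.1 e]; exact Commute.one_left _)
    omega
  have h5 : ∀ p, tlen (f (of p)) ≤ tlen (f (domWord N k n)) := by
    intro p
    by_cases hp : f (of p) = 1
    · rw [hp, tlen_one]; exact tlen_nonneg _
    by_cases hpi : Commute (f (of p)) (f (of i))
    · have hpj : ¬ Commute (f (of p)) (f (of j)) := fun hpj =>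
        hij (commute_trans hp hpi.symm hpj)
      obtain ⟨o, h6, -⟩ := h3 p j hpj
      exact (tlen_le _ o).trans h6
    · obtain ⟨o, h6, -⟩ := h3 p i hpi
      exact (tlen_le _ o).trans h6
  obtain ⟨o, ho⟩ := exists_mem_of_pairwise Finset.univ
    (fun i => {o | wdist o (f (of i) * o) ≤ tlen (f (domWord N k n))})
    (fun i _ => isGeodesicallyConvex_displacement _ _) (fun p _ q _ => by
      by_cases hpq : Commute (f (of p)) (f (of q))
      · obtain ⟨o, h6, h7⟩ := exists_wdist_le_of_commute hpq
        exact ⟨o, h6.trans (h5 p), h7.trans (h5 q)⟩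
      · obtain ⟨o, h6, h7⟩ := h3 p q hpq
        exact ⟨o, h6, h7⟩)
  exact ⟨o, fun i => ho i (Finset.mem_univ i)⟩

theorem wdist_map_le (f : FreeGroup (Fin n) →* FreeGroup α) {o : FreeGroup α} {D : ℤ}
    (h : ∀ i, wdist o (f (of i) * o) ≤ D) (z : FreeGroup (Fin n)) :
    wdist o (f z * o) ≤ z.norm * D := by
  have key : ∀ w : List (Fin n × Bool), wdist o (f (mk w) * o) ≤ w.length * D := by
    intro w
    induction w with
    | nil => simp [← one_eq_mk]
    | cons e w ih =>
      obtain ⟨i, b⟩ := e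
      have e1 : mk ((i, b) :: w) = mk [(i, b)] * mk w := by rw [mul_mk]; rfl
      have e2 : wdist o (f (mk [(i, b)]) * o) ≤ D := by
        cases b
        · have : mk [(i, false)] = (of i)⁻¹ := by simp [of, inv_mk, invRev]
          rw [this, _root_.map_inv, ← wdist_mul_left (f (of i)), mul_inv_cancel_left, wdist_comm]
          exact h i
        · exact h i
      have t := wdist_triangle o (f (mk [(i, b)]) * o) (f (mk ((i, b) :: w)) * o)
      rw [e1, _root_.map_mul, mul_assoc, wdist_mul_left] at t
      rw [e1, _root_.map_mul, mul_assoc, List.length_cons]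
      push_cast
      linarith
  simpa [mk_toWord, norm] using key z.toWord

/-- Letters and words have bounded displacement at some point of the axis of `domWord`. -/
theorem exists_isAxis_domWord (hk : 2 ≤ k) (hN : 910 ≤ N) (hn : k + 2 * (n * n) ≤ N)
    (h : ¬ ∀ i j, Commute (f (of i)) (f (of j))) :
    ∃ l, IsAxis (f (domWord N k n)) (tlen (f (domWord N k n))) l ∧
      ∀ z : FreeGroup (Fin n), wdist (l 0) (f z * l 0) ≤
        (z.norm + (domWord N k n).norm : ℕ) * tlen (f (domWord N k n)) := by
  obtain ⟨ht, o, ho⟩ := exists_wdist_le_tlen_domWord hk hN hn h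
  obtain ⟨l, ax, hl⟩ := exists_isAxis_wdist_le ht.1 o
  refine ⟨l, ax, fun z => (hl _).trans ?_⟩
  have h1 := wdist_map_le f ho z
  have h2 := wdist_map_le f ho (domWord N k n)
  have h3 := ax.pos
  push_cast
  linarith

end DomWord

variable {n : ℕ}

/-- A bound on the tags used. -/
def tagBound (n : ℕ) : ℕ := 910 + 4 * (n * n)

/-- The base of the powers in `mainWord`. -/
noncomputable def baseWord (n : ℕ) : FreeGroup (Fin n) := domWord (tagBound n) 2 n

/-- A second dominating word, which never commutes with `baseWord` on noncommuting tuples. -/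
noncomputable def sepWord (n : ℕ) : FreeGroup (Fin n) :=
  domWord (tagBound n) (2 + 2 * (n * n)) n

theorem not_commute_base_sep {f : FreeGroup (Fin n) →* FreeGroup α}
    (h : ¬ ∀ i j, Commute (f (of i)) (f (of j))) : ¬ Commute (f (baseWord n)) (f (sepWord n)) := by
  have h1 := (exists_wdist_le_tlen_domWord (N := tagBound n) (k := 2) le_rfl
    (by unfold tagBound; omega) (by unfold tagBound; omega) h).1
  have h2 := (exists_wdist_le_tlen_domWord (N := tagBound n) (k := 2 + 2 * (n * n)) (by omega)
    (by unfold tagBound; omega) (by unfold tagBound; omega) h).1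
  exact h1.not_commute h2 le_rfl le_rfl (by unfold tagBound; omega) (by unfold tagBound; omega)

/-- The exponent of `sepWord` in `letterWord`. -/
noncomputable def sepExp (n : ℕ) : ℕ :=
  50 * ((sepWord n).norm + 2) + 200 + (baseWord n).norm

theorem not_commute_base_letter {f : FreeGroup (Fin n) →* FreeGroup α}
    (h : ¬ ∀ i j, Commute (f (of i)) (f (of j))) (i : Fin n) :
    ¬ Commute (f (baseWord n)) (f (sepWord n) ^ sepExp n * f (of i)) := by
  have hbs := not_commute_base_sep h
  obtain ⟨l, ax, hl⟩ := exists_isAxis_domWord (N := tagBound n) (k := 2 + 2 * (n * n)) (by omega)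
    (by unfold tagBound; omega) (by unfold tagBound; omega) h
  change IsAxis (f (sepWord n)) (tlen (f (sepWord n))) l at ax
  change ∀ z : FreeGroup (Fin n), wdist (l 0) (f z * l 0) ≤
        (z.norm + (sepWord n).norm : ℕ) * tlen (f (sepWord n)) at hl
  have hi := hl (of i)
  rw [norm_of] at hi
  have hb := (tlen_le _ _).trans (hl (baseWord n))
  have hE : sepExp n = 50 * ((sepWord n).norm + 2) + 200 + (baseWord n).norm := rfl
  have hb1 : f (baseWord n) ≠ 1 := fun e => hbs (by rw [e]; exact Commute.one_left _)
  intro hc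
  have hL := ax.pos
  generalize tlen (f (sepWord n)) = L at *
  generalize (sepWord n).norm = Q at *
  by_cases hq : Commute (f (of i)) (f (sepWord n))
  · have hq' : Commute (f (sepWord n) ^ sepExp n * f (of i)) (f (sepWord n)) :=
      (Commute.pow_self _ _).mul_left hq
    by_cases hy : f (sepWord n) ^ sepExp n * f (of i) = 1
    · have a' := (ax.pow (k := sepExp n) (by omega)).le_wdist (f (of i) * l 0)
      rw [← mul_assoc, hy, one_mul, wdist_comm] at a'
      have := a'.trans hi
      have h2 := le_of_mul_le_mul_right this hL
      push_cast at h2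
      omega
    · exact hbs (commute_trans hy hc hq')
  · have c : IsBigConfig (1 + Q) (11 * (1 + Q) + 30) (sepExp n) 1 (f (sepWord n))
        (fun _ => f (of i)) (fun _ => sepExp n) L l :=
      { axis := ax
        disp := fun _ => hi
        ncomm := fun _ => hq
        perP := fun _ => rfl
        perM := fun _ => rfl
        m_pos := one_pos
        le_M := fun _ => by omega
        M_zero := rfl
        M_mem := fun j h0 h1 => by omega
        le_N := le_rfl
        le_T := by omega }
    have e : chainProd (f (sepWord n)) (fun _ => f (of i)) (fun _ => sepExp n) 1 =
        f (sepWord n) ^ sepExp n * f (of i) := by simp [chainProd]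
    have h1 := c.tlen_lt
    obtain ⟨k, hk⟩ := c.exists_zpow_of_commute (ρ := f (baseWord n)) (by rwa [e])
    rw [e] at hk h1
    have hk0 : k ≠ 0 := by rintro rfl; exact hb1 (by rw [hk, zpow_zero])
    have h2 := tlen_le_tlen_zpow (f (sepWord n) ^ sepExp n * f (of i)) hk0
    rw [← hk] at h2
    have h3 := lt_of_mul_lt_mul_right (h1.trans_le (h2.trans hb)) hL.le
    push_cast at h3
    omega

/-- The words separating the powers of `baseWord` in `mainWord`: for `r < n` they involve the
`r`-th letter. -/
noncomputable def letterWord (n r : ℕ) : FreeGroup (Fin n) :=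
  if h : r < n then sepWord n ^ sepExp n * of ⟨r, h⟩ else sepWord n

theorem not_commute_letterWord {f : FreeGroup (Fin n) →* FreeGroup α}
    (h : ¬ ∀ i j, Commute (f (of i)) (f (of j))) (r : ℕ) :
    ¬ Commute (f (letterWord n r)) (f (baseWord n)) := by
  unfold letterWord
  split_ifs with hr
  · rw [_root_.map_mul, _root_.map_pow]
    exact fun hc => not_commute_base_letter h ⟨r, hr⟩ hc.symm
  · exact fun hc => not_commute_base_sep h hc.symm

/-- The displacement constant of the configuration defining `mainWord`. -/
noncomputable def mainConst (n : ℕ) : ℕ :=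
  ∑ r ∈ Finset.range (n + 1), (letterWord n r).norm + (baseWord n).norm

/-- The range of the exponents in `mainWord`. -/
noncomputable def mainRange (n : ℕ) : ℕ := 11 * mainConst n + 30 + 3 * (n + 1)

/-- The exponent of the first power in `mainWord`. -/
noncomputable def mainTop (n : ℕ) : ℕ :=
  3 * (n + 1) * (2 * mainRange n + 3 * mainConst n + 6) + 4 * mainConst n + 18

/-- The exponents in `mainWord`. -/
noncomputable def mainExp (n j : ℕ) : ℕ :=
  if j % (3 * (n + 1)) = 0 then mainTop n else mainRange n + j % (3 * (n + 1))

/-- The word in `n` letters that determines endomorphisms with noncyclic image. -/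
noncomputable def mainWord (n : ℕ) : FreeGroup (Fin n) :=
  chainProd (baseWord n) (fun j => letterWord n (j % (3 * (n + 1)) / 3)) (mainExp n) (3 * (n + 1))

theorem map_mainWord {G : Type*} [Group G] (f : FreeGroup (Fin n) →* G) : f (mainWord n) =
    chainProd (f (baseWord n)) (fun j => f (letterWord n (j % (3 * (n + 1)) / 3))) (mainExp n)
      (3 * (n + 1)) := map_chainProd _ _ _ _ _

theorem exists_isBigConfig_mainWord {f : FreeGroup (Fin n) →* FreeGroup α}
    (h : ¬ ∀ i j, Commute (f (of i)) (f (of j))) :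
    ∃ L l, IsBigConfig (mainConst n) (mainRange n) (mainTop n) (3 * (n + 1)) (f (baseWord n))
      (fun j => f (letterWord n (j % (3 * (n + 1)) / 3))) (mainExp n) L l := by
  obtain ⟨l, ax, hl⟩ := exists_isAxis_domWord (N := tagBound n) (k := 2) le_rfl
    (by unfold tagBound; omega) (by unfold tagBound; omega) h
  refine ⟨_, l, ⟨⟨ax, fun j => (hl _).trans ?_, fun j => not_commute_letterWord h _,
    fun j => by simp, fun j => by simp [mainExp], by omega, fun j => ?_⟩, by simp [mainExp],
    fun j h0 h1 => ?_, ?_, le_rfl⟩⟩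
  · refine mul_le_mul_of_nonneg_right ?_ ax.pos.le
    have h1 : j % (3 * (n + 1)) / 3 ∈ Finset.range (n + 1) := by
      have := Nat.mod_lt j (show 0 < 3 * (n + 1) by omega)
      rw [Finset.mem_range]
      omega
    have h2 := Finset.single_le_sum (f := fun r => (letterWord n r).norm) (fun _ _ => Nat.zero_le _)
      h1
    exact_mod_cast Nat.add_le_add_right h2 _
  · unfold mainExp
    split_ifs
    · unfold mainTop mainRange; nlinarith [Nat.zero_le (mainConst n)]
    · unfold mainRange; omega
  · rw [mainExp, Nat.mod_eq_of_lt h1, if_neg (by omega)]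
    unfold mainRange; omega
  · unfold mainRange; omega

theorem commute_map_of_commute_of {β G : Type*} [Group G] {f : FreeGroup β →* G}
    (h : ∀ i j, Commute (f (of i)) (f (of j))) (x y : FreeGroup β) : Commute (f x) (f y) := by
  have h1 : ∀ i, Commute (f (of i)) (f y) := by
    intro i
    induction y using FreeGroup.induction_on with
    | C1 => simp
    | of j => exact h i j
    | inv_of j hj => rw [_root_.map_inv]; exact hj.inv_right
    | mul x y hx hy => rw [_root_.map_mul]; exact hx.mul_right hy
  induction x using FreeGroup.induction_on with
  | C1 => simp
  | of j => exact h1 j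
  | inv_of j hj => rw [_root_.map_inv]; exact hj.inv_left
  | mul x y hx hy => rw [_root_.map_mul]; exact hx.mul_left hy

omit [DecidableEq α] in
theorem exists_cube_eq_map_mainWord {f : FreeGroup (Fin n) →* FreeGroup α}
    (h : ∀ i j, Commute (f (of i)) (f (of j))) : ∃ ρ, f (mainWord n) = ρ ^ 3 := by
  have hcomm := commute_map_of_commute_of h
  have key : ∀ r ≤ n + 1, ∃ ρ, chainProd (1 : FreeGroup α)
      (fun j => f (letterWord n (j % (3 * (n + 1)) / 3))) (mainExp n) (3 * r) = f ρ ^ 3 := by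
    intro r hr
    induction r with
    | zero => exact ⟨1, by simp [chainProd]⟩
    | succ r ih =>
      obtain ⟨ρ, hρ⟩ := ih (by omega)
      refine ⟨ρ * letterWord n r, ?_⟩
      rw [_root_.map_mul, (hcomm _ _).mul_pow, ← hρ, show 3 * (r + 1) = 3 * r + 1 + 1 + 1 by ring]
      simp only [chainProd, one_pow, mul_one]
      rw [Nat.mod_eq_of_lt (by omega), Nat.mod_eq_of_lt (by omega), Nat.mod_eq_of_lt (by omega),
        show 3 * r / 3 = r by omega, show (3 * r + 1) / 3 = r by omega,
        show (3 * r + 1 + 1) / 3 = r by omega, pow_succ, pow_two]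
      simp only [mul_assoc]
  obtain ⟨ρ, hρ⟩ := key (n + 1) le_rfl
  exact ⟨f ρ, by rw [map_mainWord, baseWord, map_domWord_eq_one f h, hρ]⟩

theorem not_commute_of_map_mainWord_eq {f g : FreeGroup (Fin n) →* FreeGroup α}
    (hg : ¬ ∀ i j, Commute (g (of i)) (g (of j))) (h : f (mainWord n) = g (mainWord n)) :
    ¬ ∀ i j, Commute (f (of i)) (f (of j)) := by
  intro hf
  obtain ⟨ρ, hρ⟩ := exists_cube_eq_map_mainWord hf
  obtain ⟨L, l, c⟩ := exists_isBigConfig_mainWord hg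
  have hc : Commute ρ (g (mainWord n)) := by
    rw [← h, hρ]; exact Commute.self_pow _ _
  have h1 : g (mainWord n) ≠ 1 := by rw [map_mainWord]; exact c.ne_one
  rw [map_mainWord g] at hc
  obtain ⟨k, hk⟩ := c.exists_zpow_of_commute hc
  rw [← map_mainWord] at hk
  have : g (mainWord n) ^ (k * 3 - 1) = 1 := by
    rw [zpow_sub_one, zpow_mul, ← hk, ← h, hρ]
    norm_cast
    simp
  have := (IsMulTorsionFree.zpow_eq_one_iff_right h1).1 this
  omega

theorem exists_conj_of_map_mainWord_eq {f g : FreeGroup (Fin n) →* FreeGroup α}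
    (hg : ¬ ∀ i j, Commute (g (of i)) (g (of j))) (h : f (mainWord n) = g (mainWord n)) :
    g (mainWord n) ≠ 1 ∧
      ∃ k : ℤ, ∀ x, f x = g (mainWord n) ^ k * g x * (g (mainWord n) ^ k)⁻¹ := by
  have hf := not_commute_of_map_mainWord_eq hg h
  obtain ⟨L, l, c⟩ := exists_isBigConfig_mainWord hg
  obtain ⟨L', l', c'⟩ := exists_isBigConfig_mainWord hf
  refine ⟨by rw [map_mainWord]; exact c.ne_one, ?_⟩
  have hu := c.axis.ne_one
  obtain ⟨k, s, z, hs, z0, -, huv, hz, key⟩ :=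
    c.decode c' (by rw [← map_mainWord, ← map_mainWord, h])
  rw [← map_mainWord] at hs
  have key' := fun i j => eq_of_decode (i := i) (j := j) hu huv hz c.ncomm key
  have hP : ∀ r ≤ n, ∀ e < 3, (3 * r + e) % (3 * (n + 1)) / 3 = r := fun r hr e he => by
    rw [Nat.mod_eq_of_lt (by omega)]; omega
  have step : ∀ r ≤ n, ∀ e < 2, ((s * f (baseWord n) * s⁻¹) ^ mainExp n (3 * r + e))⁻¹ *
      (z (3 * r + e))⁻¹ * g (baseWord n) ^ mainExp n (3 * r + e) =
      ((s * f (baseWord n) * s⁻¹) ^ mainExp n (3 * r + (e + 1)))⁻¹ *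
      (z (3 * r + (e + 1)))⁻¹ * g (baseWord n) ^ mainExp n (3 * r + (e + 1)) ∧
      z (3 * r + (e + 1)) = z (3 * r + (e + 2)) := fun r hr e he =>
    key' _ _ (by simp only [hP r hr e (by omega), hP r hr (e + 1) (by omega)])
      (by simp only [hP r hr e (by omega), hP r hr (e + 1) (by omega)])
  have huv' : s * f (baseWord n) * s⁻¹ = g (baseWord n) := by
    obtain ⟨e1, -⟩ := step 0 (by omega) 1 (by omega)
    rw [← (step 0 (by omega) 0 (by omega)).2] at e1
    have e2 := zpow_eq_of_decode (hz _) e1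
    have e3 : mainExp n (3 * 0 + (1 + 1)) = mainExp n (3 * 0 + 1) + 1 := by
      simp only [mainExp, mul_zero, zero_add]
      rw [Nat.mod_eq_of_lt (by omega), Nat.mod_eq_of_lt (by omega)]
      simp
    rw [e3] at e2
    simpa using e2.symm
  rw [huv'] at key step
  have hz' : ∀ i, (g (baseWord n) ^ mainExp n i)⁻¹ * (z i)⁻¹ * g (baseWord n) ^ mainExp n i =
      (z i)⁻¹ := fun i => by
    rw [mul_assoc, (((hz i).inv_left).pow_right _).eq, inv_mul_cancel_left]
  simp only [hz', inv_inj] at key step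
  have hz1 : ∀ r ≤ n + 1, z (3 * r) = 1 := by
    intro r hr
    induction r with
    | zero => exact z0
    | succ r ih =>
      rw [← ih (by omega)]
      have s0 := step r (by omega) 0 (by omega)
      have s1 := step r (by omega) 1 (by omega)
      exact ((s0.1.trans s0.2).trans s1.2).symm
  have hletter : ∀ r ≤ n, s * f (letterWord n r) * s⁻¹ = g (letterWord n r) := by
    intro r hr
    have := key (3 * r)
    have e0 := (step r hr 0 (by omega)).1
    have e1 := hP r hr 0 (by omega)
    simp only [add_zero, zero_add] at e0 e1
    rw [hz1 r (by omega), ← e0, hz1 r (by omega), e1] at this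
    simpa using this
  have hsep : s * f (sepWord n) * s⁻¹ = g (sepWord n) := by
    simpa [letterWord] using hletter n le_rfl
  have hconj : (MulAut.conj s).toMonoidHom.comp f = g := by
    ext i
    have := hletter i i.2.le
    simp only [letterWord, i.2, dif_pos, _root_.map_mul, _root_.map_pow, ← hsep, conj_pow] at this
    change s * f (of i) * s⁻¹ = g (of i)
    refine mul_left_cancel (a := s * f (sepWord n) ^ sepExp n * s⁻¹) (Eq.trans ?_ this)
    group
  refine ⟨-k, fun x => ?_⟩
  rw [zpow_neg, ← hs, ← hconj]
  simp [mul_assoc]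

end FreeGroup

/-- (Lee) For every `n ≥ 2` there is a word `w ∈ F_n` such that any two endomorphisms of
`F_n` agreeing on `w`, the second having non-cyclic image, differ by conjugation by an
element `S` generating together with `Ψ w` an infinite cyclic subgroup; for `n = 2` the
element `S` can be chosen to be a power of `Ψ w`. -/
theorem exists_word_endomorphisms_agree (n : ℕ) (hn : 2 ≤ n) :
    ∃ w : FreeGroup (Fin n),
      ∀ φ Ψ : FreeGroup (Fin n) →* FreeGroup (Fin n),
        (¬ ∃ g : FreeGroup (Fin n), Ψ.range = Subgroup.zpowers g) →
        φ w = Ψ w →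
        ∃ S : FreeGroup (Fin n),
          (∀ g : FreeGroup (Fin n), φ g = S * Ψ g * S⁻¹) ∧
          (∃ z : FreeGroup (Fin n), ¬ IsOfFinOrder z ∧
            Subgroup.closure {S, Ψ w} = Subgroup.zpowers z) ∧
          (n = 2 → ∃ k : ℤ, S = (Ψ w) ^ k) := by
  refine ⟨FreeGroup.mainWord n, fun φ Ψ hΨ h => ?_⟩
  have hc : ¬ ∀ i j, Commute (Ψ (.of i)) (Ψ (.of j)) := fun hc => hΨ <| by
    apply FreeGroup.exists_zpowers_of_commute
    rintro _ ⟨x, rfl⟩ _ ⟨y, rfl⟩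
    exact FreeGroup.commute_map_of_commute_of hc x y
  obtain ⟨h1, k, hk⟩ := FreeGroup.exists_conj_of_map_mainWord_eq hc h
  refine ⟨_, hk, ⟨Ψ (FreeGroup.mainWord n), not_isOfFinOrder_of_isMulTorsionFree h1,
    le_antisymm ?_ ?_⟩, fun _ => ⟨k, rfl⟩⟩
  · refine (Subgroup.closure_le _).2 ?_
    rintro x (rfl | rfl)
    · exact Subgroup.zpow_mem_zpowers _ _
    · exact Subgroup.mem_zpowers _
  · exact Subgroup.zpowers_le.2 (Subgroup.subset_closure (by simp))
end

section
/- Let w ∈ F₂ be an Ivanov word and let G_w be the double of F₂ along w. Then for every set S and every group homomorphism φ : G_w → FreeGroup S, at least one of the following holds: (a) φ(ι_A(w)) = 1 and both image subgroups φ(ι_A(F₂)) and φ(ι_B(F₂)) of FreeGroup S are cyclic (so φ factors through the projection η : G_w → ℤ² ∗ ℤ²); or (b) there exists k ∈ ℤ such that φ(ι_B(g)) = φ(ι_A(w))^k · φ(ι_A(g)) · φ(ι_A(w))^{-k} for all g ∈ F₂ (so that, after precomposition with the Dehn twist along ⟨w⟩ given on the two copies by the identity on A and conjugation by w^k on B,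 φ factors through the canonical retraction π : G_w → A). -/
/-- The diagram of the double: two copies of `F₂`, each receiving `ℤ` via `1 ↦ w`. -/
def doubleMaps (w : FreeGroup (Fin 2)) :
    ∀ _ : Bool, Multiplicative ℤ →* FreeGroup (Fin 2) :=
  fun _ => zpowersHom (FreeGroup (Fin 2)) w

/-- The double `G_w` of `F₂` along `w`, as the pushout of `ℤ → F₂, 1 ↦ w` with itself. -/
def Double (w : FreeGroup (Fin 2)) : Type := Monoid.PushoutI (doubleMaps w)

instance (w : FreeGroup (Fin 2)) : Group (Double w) :=
  inferInstanceAs (Group (Monoid.PushoutI (doubleMaps w)))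

/-- The embedding of the first copy `A` of `F₂` into the double. -/
def ιA (w : FreeGroup (Fin 2)) : FreeGroup (Fin 2) →* Double w :=
  Monoid.PushoutI.of (φ := doubleMaps w) true

/-- The embedding of the second copy `B` of `F₂` into the double. -/
def ιB (w : FreeGroup (Fin 2)) : FreeGroup (Fin 2) →* Double w :=
  Monoid.PushoutI.of (φ := doubleMaps w) false


/-- `w ∈ F₂` is a C-test word with respect to the free group `FreeGroup S`. -/
def IsCTestWord₂ (w : FreeGroup (Fin 2)) (S : Type*) : Prop :=
  w ≠ 1 ∧ ∀ A₁ A₂ B₁ B₂ : FreeGroup S,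
    FreeGroup.lift ![A₁, A₂] w = FreeGroup.lift ![B₁, B₂] w →
    FreeGroup.lift ![A₁, A₂] w ≠ 1 →
      ∃ s : FreeGroup S, s * A₁ * s⁻¹ = B₁ ∧ s * A₂ * s⁻¹ = B₂

/-- An element of a group is a proper power if it is `v ^ k` for some `k ≥ 2`. -/
def IsProperPower {G : Type*} [Group G] (w : G) : Prop :=
  ∃ (v : G) (k : ℕ), 2 ≤ k ∧ w = v ^ k

/-- `w ∈ F₂` is an Ivanov word. -/
def IsIvanovWord (w : FreeGroup (Fin 2)) : Prop :=
  (∀ S : Type, Nontrivial S → IsCTestWord₂ w S) ∧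
  ¬ IsProperPower w ∧
  (∀ (S : Type) (A₁ A₂ : FreeGroup S),
    FreeGroup.lift ![A₁, A₂] w = 1 ↔
      ∃ g : FreeGroup S, Subgroup.closure {A₁, A₂} = Subgroup.zpowers g) ∧
  (∀ (S : Type) (φ Ψ : FreeGroup (Fin 2) →* FreeGroup S),
    (¬ ∃ g : FreeGroup S, Ψ.range = Subgroup.zpowers g) →
    φ w = Ψ w →
    ∃ k : ℤ, ∀ g : FreeGroup (Fin 2),
      φ g = (Ψ w) ^ k * Ψ g * (Ψ w) ^ (-k))

theorem ιA_self_eq_ιB_self (w : FreeGroup (Fin 2)) : ιA w w = ιB w w := by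
  have h (i : Bool) : Monoid.PushoutI.of (φ := doubleMaps w) i w =
      Monoid.PushoutI.base (doubleMaps w) (Multiplicative.ofAdd 1) := by
    rw [← Monoid.PushoutI.of_apply_eq_base (doubleMaps w) i]
    simp [doubleMaps]
  exact (h true).trans (h false).symm

theorem FreeGroup.lift_pair_eq {G : Type*} [Group G] (f : FreeGroup (Fin 2) →* G) :
    FreeGroup.lift ![f (FreeGroup.of 0), f (FreeGroup.of 1)] = f := by
  ext i
  fin_cases i <;> simp

theorem FreeGroup.closure_pair_eq_range {G : Type*} [Group G] (f : FreeGroup (Fin 2) →* G) :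
    Subgroup.closure {f (FreeGroup.of 0), f (FreeGroup.of 1)} = f.range := by
  conv_rhs => rw [← FreeGroup.lift_pair_eq f, FreeGroup.range_lift_eq_closure]
  simp [Matrix.range_cons, Set.pair_comm]

/-- A homomorphism to a free group kills an Ivanov word iff its image is cyclic. -/
theorem IsIvanovWord.map_eq_one_iff {w : FreeGroup (Fin 2)} (hw : IsIvanovWord w)
    {S : Type} (f : FreeGroup (Fin 2) →* FreeGroup S) :
    f w = 1 ↔ ∃ g : FreeGroup S, f.range = Subgroup.zpowers g := by
  have h := hw.2.2.1 S (f (FreeGroup.of 0)) (f (FreeGroup.of 1))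
  rwa [FreeGroup.lift_pair_eq, FreeGroup.closure_pair_eq_range] at h

/-- Every homomorphism from the double of `F₂` along an Ivanov word to a free group either
kills `w` and has cyclic images on both copies of `F₂` (hence factors through `ℤ² ∗ ℤ²`),
or agrees on the two copies up to conjugation by a power of the image of `w` (hence, after
precomposition with a Dehn twist, factors through the retraction onto `A`). -/
theorem hom_double_ivanov_factors (w : FreeGroup (Fin 2)) (hw : IsIvanovWord w)
    (S : Type) (φ : Double w →* FreeGroup S) :
    (φ (ιA w w) = 1 ∧
      (∃ g : FreeGroup S, Subgroup.map φ (ιA w).range = Subgroup.zpowers g) ∧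
      (∃ g : FreeGroup S, Subgroup.map φ (ιB w).range = Subgroup.zpowers g)) ∨
    (∃ k : ℤ, ∀ g : FreeGroup (Fin 2),
      φ (ιB w g) = (φ (ιA w w)) ^ k * φ (ιA w g) * (φ (ιA w w)) ^ (-k)) := by
  have hAB : φ (ιB w w) = φ (ιA w w) := by rw [ιA_self_eq_ιB_self]
  by_cases hA : φ (ιA w w) = 1
  · refine Or.inl ⟨hA, ?_, ?_⟩
    · rw [MonoidHom.map_range]
      exact (hw.map_eq_one_iff (φ.comp (ιA w))).1 hA
    · rw [MonoidHom.map_range]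
      exact (hw.map_eq_one_iff (φ.comp (ιB w))).1 (hAB.trans hA)
  · exact Or.inr (hw.2.2.2 S (φ.comp (ιB w)) (φ.comp (ιA w))
      (fun h => hA ((hw.map_eq_one_iff (φ.comp (ιA w))).2 h)) hAB)
end

section
/- Let w ∈ F₂ be non-trivial and not a proper power, and let G_w be the double of F₂ along w. Let E denote the HNN extension of F₂ with both associated subgroups equal to ⟨w⟩ and identifying isomorphism the identity (the extension of centralizers ⟨F₂, t | t w t⁻¹ = w⟩, in Mathlib HNNExtension F₂ ⟨w⟩ ⟨w⟩ id). Then there is an injective group homomorphism Φ : G_w → E satisfying Φ(ι_A(g)) = g and Φ(ι_B(g)) = t g t⁻¹ for all g ∈ F₂, where t denotes the stable letter. In particular G_w embeds into an extension of centralizers of F₂ and hence is a limit group. -/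
namespace Double

variable {w : FreeGroup (Fin 2)} {K : Type*} [Group K]

/-- The homomorphism out of the double induced by two homomorphisms that agree on `w`. -/
def lift (f g : FreeGroup (Fin 2) →* K) (h : f w = g w) : Double w →* K :=
  Monoid.PushoutI.lift (φ := doubleMaps w) (fun i => bif i then f else g) (zpowersHom K (f w)) <| by
    intro i
    ext
    cases i <;> simp [doubleMaps, h]

@[simp]
theorem lift_ιA (f g : FreeGroup (Fin 2) →* K) (h : f w = g w) (x : FreeGroup (Fin 2)) :
    lift f g h (ιA w x) = f x :=
  Monoid.PushoutI.lift_of (φ := doubleMaps w) _ _ _ (i := true) x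

@[simp]
theorem lift_ιB (f g : FreeGroup (Fin 2) →* K) (h : f w = g w) (x : FreeGroup (Fin 2)) :
    lift f g h (ιB w x) = g x :=
  Monoid.PushoutI.lift_of (φ := doubleMaps w) _ _ _ (i := false) x

theorem hom_ext {f g : Double w →* K} (hA : ∀ x, f (ιA w x) = g (ιA w x))
    (hB : ∀ x, f (ιB w x) = g (ιB w x)) : f = g :=
  Monoid.PushoutI.hom_ext_nonempty (φ := doubleMaps w) fun i => by
    cases i
    · exact MonoidHom.ext hB
    · exact MonoidHom.ext hA

/-- The endomorphism of the double exchanging the two copies of `F₂`. -/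
def swapHom (w : FreeGroup (Fin 2)) : Double w →* Double w :=
  lift (ιB w) (ιA w) (ιA_self_eq_ιB_self w).symm

theorem swapHom_comp_swapHom (w : FreeGroup (Fin 2)) :
    (swapHom w).comp (swapHom w) = MonoidHom.id _ :=
  hom_ext (by simp [swapHom]) (by simp [swapHom])

/-- The automorphism of the double exchanging the two copies of `F₂`. -/
def swap (w : FreeGroup (Fin 2)) : MulAut (Double w) :=
  (swapHom w).toMulEquiv (swapHom w) (swapHom_comp_swapHom w) (swapHom_comp_swapHom w)

@[simp]
theorem swap_ιA (x : FreeGroup (Fin 2)) : swap w (ιA w x) = ιB w x := by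
  simp [swap, swapHom]

/-- The canonical homomorphism from the double to the extension of centralizers. -/
def toHNNExtension (w : FreeGroup (Fin 2)) :
    Double w →* HNNExtension (FreeGroup (Fin 2)) (Subgroup.zpowers w) (Subgroup.zpowers w)
      (MulEquiv.refl _) :=
  lift HNNExtension.of ((MulAut.conj HNNExtension.t).toMonoidHom.comp HNNExtension.of) <| by
    simpa using HNNExtension.equiv_eq_conj (φ := MulEquiv.refl (Subgroup.zpowers w))
      ⟨w, Subgroup.mem_zpowers w⟩

/-- The homomorphism from the extension of centralizers to the holomorph of the double sending
the stable letter to the swap of the two copies of `F₂`. -/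
def ofHNNExtension (w : FreeGroup (Fin 2)) :
    HNNExtension (FreeGroup (Fin 2)) (Subgroup.zpowers w) (Subgroup.zpowers w)
      (MulEquiv.refl _) →* Double w ⋊[MonoidHom.id (MulAut (Double w))] MulAut (Double w) :=
  HNNExtension.lift (SemidirectProduct.inl.comp (ιA w)) (SemidirectProduct.inr (swap w)) <| by
    rintro ⟨_, n, rfl⟩
    have h : ιB w (w ^ n) = ιA w (w ^ n) := by simp only [map_zpow, ιA_self_eq_ιB_self]
    ext : 1 <;> simp [-map_zpow, h]

theorem ofHNNExtension_comp_toHNNExtension (w : FreeGroup (Fin 2)) :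
    (ofHNNExtension w).comp (toHNNExtension w) = SemidirectProduct.inl := by
  refine hom_ext (fun x => by simp [toHNNExtension, ofHNNExtension]) fun x => ?_
  ext : 1 <;> simp [toHNNExtension, ofHNNExtension]

theorem toHNNExtension_injective (w : FreeGroup (Fin 2)) :
    Function.Injective (toHNNExtension w) := by
  refine Function.Injective.of_comp (f := ofHNNExtension w) ?_
  rw [← MonoidHom.coe_comp, ofHNNExtension_comp_toHNNExtension]
  exact SemidirectProduct.inl_injective

end Double

/-- The double of `F₂` along a non-trivial element `w` that is not a proper power embeds
into the extension of centralizers `⟨F₂, t | t w t⁻¹ = w⟩` via `ι_A(g) ↦ g`,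
`ι_B(g) ↦ t g t⁻¹`; hence it is a limit group. -/
theorem double_embeds_in_centralizer_extension (w : FreeGroup (Fin 2)) (hw : w ≠ 1)
    (hpow : ¬ IsProperPower w) :
    ∃ Φ : Double w →*
        HNNExtension (FreeGroup (Fin 2)) (Subgroup.zpowers w) (Subgroup.zpowers w)
          (MulEquiv.refl _),
      Function.Injective Φ ∧
      (∀ g : FreeGroup (Fin 2), Φ (ιA w g) = HNNExtension.of g) ∧
      (∀ g : FreeGroup (Fin 2),
        Φ (ιB w g) = HNNExtension.t * HNNExtension.of g * HNNExtension.t⁻¹) := by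
  exact ⟨Double.toHNNExtension w, Double.toHNNExtension_injective w,
    fun g => by simp [Double.toHNNExtension], fun g => by simp [Double.toHNNExtension]⟩
end
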